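/- Let G be a finite simple graph with at least two vertices that is 4-edge-connected: G is connected and remains connected after the deletion of any set of at most 3 edges. Then G is rigid in every two-dimensional real normed space whose norm is not induced by an inner product: for every such space X there is a well-positioned placement p of G in X such that every u : V(G) → X with D(p_v − p_w)(u_v − u_w) = 0 for all edges vw is a constant map. -/

import Mathlib

section

open Filter Topology Set

/-- The right derivative of a convex function on the line is continuous from the right. -/
theorem ConvexOn.tendsto_rightDeriv {N : ℝ → ℝ} (hN : ConvexOn ℝ univ N) (hc : Continuous N)
    (t : ℝ) :
    Tendsto (fun s => derivWithin N (Ioi s) s) (𝓝[>] t) (𝓝 (derivWithin N (Ioi t) t)) := by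
  have hinter : ∀ s : ℝ, s ∈ interior (univ : Set ℝ) := by simp
  have hmono : ∀ s, t < s → derivWithin N (Ioi t) t ≤ derivWithin N (Ioi s) s := fun s hs =>
    hN.monotoneOn_rightDeriv (hinter t) (hinter s) hs.le
  refine tendsto_order.2 ⟨fun a ha => ?_, fun a ha => ?_⟩
  · filter_upwards [self_mem_nhdsWithin] with s hs using ha.trans_le (hmono s hs)
  · have h1 := (hasDerivWithinAt_iff_tendsto_slope' (self_notMem_Ioi)).1
      (hN.hasDerivWithinAt_rightDeriv_of_mem_interior (hinter t))
    obtain ⟨y, hya, hty⟩ := ((h1.eventually_lt_const ha).and self_mem_nhdsWithin).exists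
    have h2 : Tendsto (fun s => slope N s y) (𝓝 t) (𝓝 (slope N t y)) := by
      simp only [slope_def_field]
      have : y - t ≠ 0 := sub_ne_zero.2 (ne_of_gt hty)
      exact ContinuousAt.tendsto (by fun_prop (disch := assumption))
    filter_upwards [(h2.eventually_lt_const hya).filter_mono nhdsWithin_le_nhds,
      (eventually_lt_nhds hty).filter_mono nhdsWithin_le_nhds] with s hs hsy
    exact (hN.rightDeriv_le_slope_of_mem_interior (hinter s) (mem_univ y) hsy).trans_lt hs

/-- A solution of Jensen's functional equation that is continuous from the right is affine. -/
theorem exists_affine_of_jensen {φ : ℝ → ℝ} (hJ : ∀ t d, φ (t + d) + φ (t - d) = 2 * φ t)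
    (hr : Tendsto φ (𝓝[>] 0) (𝓝 (φ 0))) : ∃ α β : ℝ, ∀ t, φ t = α * t + β := by
  let ψ : ℝ →+ ℝ := AddMonoidHom.mk' (fun t => φ t - φ 0) (by
    intro a b
    have h1 := hJ ((a + b) / 2) ((a - b) / 2)
    have h2 := hJ ((a + b) / 2) ((a + b) / 2)
    rw [show (a + b) / 2 + (a - b) / 2 = a by ring,
      show (a + b) / 2 - (a - b) / 2 = b by ring] at h1
    rw [show (a + b) / 2 + (a + b) / 2 = a + b by ring, sub_self] at h2
    linarith)
  have hψ : ∀ t, ψ t = φ t - φ 0 := fun t => rfl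
  have hright : Tendsto ψ (𝓝[>] 0) (𝓝 0) := by
    have h := hr.sub_const (φ 0)
    rw [sub_self] at h
    exact h
  have hleft : Tendsto ψ (𝓝[<] 0) (𝓝 0) := by
    have hneg : Tendsto (fun t : ℝ => -t) (𝓝[<] 0) (𝓝[>] 0) := by
      simpa using tendsto_neg_nhdsLT (a := (0 : ℝ))
    have := (hright.comp hneg).neg
    simpa [Function.comp_def] using this
  have hcont : Continuous ψ := by
    refine continuous_of_continuousAt_zero ψ ?_
    rw [continuousAt_iff_punctured_nhds, map_zero, ← nhdsLT_sup_nhdsGT]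
    exact hleft.sup hright
  refine ⟨ψ 1, φ 0, fun t => ?_⟩
  have := map_real_smul ψ hcont t 1
  simp only [smul_eq_mul, mul_one] at this
  rw [hψ] at this
  linarith

theorem monotone_of_rightDeriv_nonneg {g g' : ℝ → ℝ} (hg : Continuous g)
    (hg' : ∀ x, HasDerivWithinAt g (g' x) (Ici x) x) (h0 : ∀ x, 0 ≤ g' x) : Monotone g := by
  intro a b hab
  exact image_le_of_deriv_right_le_deriv_boundary (f := fun _ => g a) (f' := fun _ => 0)
    continuousOn_const (fun x _ => hasDerivWithinAt_const _ _ _) le_rfl hg.continuousOn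
    (fun x _ => hg' x) (fun x _ => h0 x) ⟨hab, le_rfl⟩

theorem eq_of_monotone_of_tendsto {g : ℝ → ℝ} {l : ℝ} (hg : Monotone g)
    (hb : Tendsto g atBot (𝓝 l)) (ht : Tendsto g atTop (𝓝 l)) (x : ℝ) : g x = l :=
  le_antisymm (hg.ge_of_tendsto ht x) (hg.le_of_tendsto hb x)

/-- A positive function asymptotic to `|t|` whose right derivative solves
`N' (1 + β t + α t ^ 2) = (α t + β) N` is a hyperbola branch. -/
theorem sq_eq_of_rightDeriv_eq {N : ℝ → ℝ} (hcont : Continuous N) (hlow : ∀ t, |t| ≤ N t) {C : ℝ}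
    (hup : ∀ t, N t ≤ |t| + C) (hpos : ∀ t, 0 < N t) {α β : ℝ}
    (hQ : ∀ t, 0 < 1 + β * t + α * t ^ 2)
    (hder : ∀ t, HasDerivWithinAt N ((α * t + β) * N t / (1 + β * t + α * t ^ 2)) (Ici t) t) :
    ∃ K > 0, ∀ t, N t ^ 2 = K + t ^ 2 := by
  have hdisc := discrim_le_zero (a := α) (b := β) (c := 1) fun x => by nlinarith [hQ x]
  unfold discrim at hdisc
  have hα : 0 < α := by
    rcases lt_trichotomy α 0 with h | h | h
    · nlinarith [sq_nonneg β]
    · have hβ : β = 0 := by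
        have : β ^ 2 ≤ 0 := by nlinarith
        exact pow_eq_zero_iff two_ne_zero |>.1 (le_antisymm this (sq_nonneg _))
      subst h hβ
      exfalso
      have hz : ∀ t, HasDerivWithinAt N 0 (Ici t) t := fun t => by simpa using hder t
      have h1 := constant_of_has_deriv_right_zero (a := 0) (b := N 0 + 1) hcont.continuousOn
        (fun x _ => hz x) (N 0 + 1) ⟨by linarith [hpos 0], le_rfl⟩
      have h2 := hlow (N 0 + 1)
      rw [abs_of_pos (by linarith [hpos 0])] at h2
      linarith
    · exact h
  set G : ℝ → ℝ := fun t => N t ^ 2 / (1 + β * t + α * t ^ 2) with hG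
  have hGc : Continuous G := by
    refine (hcont.pow 2).div (by fun_prop) fun t => (hQ t).ne'
  have hGd : ∀ t, HasDerivWithinAt G (β * (N t ^ 2 / (1 + β * t + α * t ^ 2) ^ 2)) (Ici t) t := by
    intro t
    have h1 : HasDerivAt (fun t : ℝ => 1 + β * t + α * t ^ 2) (β + 2 * α * t) t := by
      have := (((hasDerivAt_id t).const_mul β).const_add 1).add ((hasDerivAt_pow 2 t).const_mul α)
      exact this.congr_deriv (by push_cast; ring)
    have h2 := ((hder t).pow 2).div h1.hasDerivWithinAt (hQ t).ne'
    refine h2.congr_deriv ?_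
    rw [mul_assoc, div_mul_cancel₀ _ (hQ t).ne', Pi.pow_apply, ← mul_div_assoc]
    congr 1
    push_cast
    ring
  have hlim : ∀ l : Filter ℝ, Tendsto (fun t : ℝ => t⁻¹) l (𝓝 0) → (∀ᶠ t in l, t ≠ 0) →
      Tendsto G l (𝓝 (1 / α)) := by
    intro l hl hne
    have hs : ∀ C : ℝ, Tendsto (fun t : ℝ => (1 + C * |t⁻¹|) ^ 2 /
        (t⁻¹ ^ 2 + β * t⁻¹ + α)) l (𝓝 (1 / α)) := by
      intro C
      have : Tendsto (fun s : ℝ => (1 + C * |s|) ^ 2 / (s ^ 2 + β * s + α)) (𝓝 0) (𝓝 (1 / α)) := by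
        have : ContinuousAt (fun s : ℝ => (1 + C * |s|) ^ 2 / (s ^ 2 + β * s + α)) 0 := by
          refine ContinuousAt.div (by fun_prop) (by fun_prop) (by simpa using hα.ne')
        simpa [ContinuousAt] using this
      exact this.comp hl
    have hrew : ∀ (C t : ℝ), t ≠ 0 → (1 + C * |t⁻¹|) ^ 2 / (t⁻¹ ^ 2 + β * t⁻¹ + α) =
        (|t| + C) ^ 2 / (1 + β * t + α * t ^ 2) := by
      intro C t ht
      have h3 : t⁻¹ ^ 2 + β * t⁻¹ + α = (1 + β * t + α * t ^ 2) / |t| ^ 2 := by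
        rw [sq_abs]; field_simp
      have h4 : 1 + C * |t⁻¹| = (|t| + C) / |t| := by
        rw [abs_inv]; have := abs_ne_zero.2 ht; field_simp
      have := abs_ne_zero.2 ht
      have h5 := (hQ t).ne'
      rw [h3, h4]; field_simp
    refine tendsto_of_tendsto_of_tendsto_of_le_of_le' (hs 0) (hs C) ?_ ?_
    · filter_upwards [hne] with t ht
      rw [hrew 0 t ht, add_zero]
      have := hQ t
      simp only [hG]
      gcongr
      exact hlow t
    · filter_upwards [hne] with t ht
      rw [hrew C t ht]
      have := hQ t
      have := (hpos t).le
      simp only [hG]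
      gcongr
      exact hup t
  have htop := hlim atTop tendsto_inv_atTop_zero (eventually_ne_atTop 0)
  have hbot := hlim atBot tendsto_inv_atBot_zero (eventually_ne_atBot 0)
  have hconst : ∀ t, G t = 1 / α := by
    rcases le_total 0 β with hβ | hβ
    · exact eq_of_monotone_of_tendsto (monotone_of_rightDeriv_nonneg hGc hGd fun x =>
        mul_nonneg hβ (by positivity)) hbot htop
    · intro t
      have := eq_of_monotone_of_tendsto (g := fun t => -G t)
        (monotone_of_rightDeriv_nonneg hGc.neg (fun x => (hGd x).neg) fun x => by
          rw [← neg_mul]; exact mul_nonneg (by linarith) (by positivity)) hbot.neg htop.neg t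
      linarith
  have hβ : β = 0 := by
    have h1 := hGd 0
    rw [show G = fun _ => 1 / α from funext hconst] at h1
    have h2 := (uniqueDiffWithinAt_Ici (0 : ℝ)).eq_deriv _ h1 (hasDerivWithinAt_const _ _ _)
    have := (hpos 0).ne'
    simpa [this] using h2
  subst hβ
  refine ⟨1 / α, by positivity, fun t => ?_⟩
  have h1 := hconst t
  have h2 := hQ t
  simp only [hG] at h1
  rw [div_eq_iff h2.ne'] at h1
  rw [h1]
  field_simp
  ring

/-- A convex function, asymptotic to `|t|`, whose tangent directions satisfy the harmonic relation
at all triples `t - d, t, t + d` of points of differentiability, is a hyperbola branch. -/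
theorem sq_eq_of_harmonic {N : ℝ → ℝ} (hconv : ConvexOn ℝ univ N)
    (hlow : ∀ t, |t| ≤ N t) {C : ℝ} (hup : ∀ t, N t ≤ |t| + C) (hpos : ∀ t, 0 < N t)
    (hlip : LipschitzWith 1 N)
    (hrel : ∀ t d, DifferentiableAt ℝ N t → DifferentiableAt ℝ N (t + d) →
      DifferentiableAt ℝ N (t - d) → N t - t * deriv N t ≠ 0 →
      (N (t + d) - (t + d) * deriv N (t + d)) * (deriv N (t - d) * (N t - t * deriv N t) -
        (N (t - d) - (t - d) * deriv N (t - d)) * deriv N t) +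
      (N (t - d) - (t - d) * deriv N (t - d)) * (deriv N (t + d) * (N t - t * deriv N t) -
        (N (t + d) - (t + d) * deriv N (t + d)) * deriv N t) = 0) :
    ∃ K > 0, ∀ t, N t ^ 2 = K + t ^ 2 := by
  have hcont : Continuous N := hlip.continuous
  have hae : ∀ᵐ t, DifferentiableAt ℝ N t := hlip.ae_differentiableAt_real
  have hinter : ∀ s : ℝ, s ∈ interior (univ : Set ℝ) := by simp
  set a : ℝ → ℝ := fun t => derivWithin N (Ioi t) t with ha
  have had : ∀ t, HasDerivWithinAt N (a t) (Ici t) t := fun t =>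
    (hconv.hasDerivWithinAt_rightDeriv_of_mem_interior (hinter t)).Ici_of_Ioi
  have hderiv : ∀ t, DifferentiableAt ℝ N t → deriv N t = a t := fun t ht =>
    (ht.hasDerivAt.hasDerivWithinAt.derivWithin (uniqueDiffWithinAt_Ioi t)).symm
  set c : ℝ → ℝ := fun t => N t - t * a t with hc
  have hatend : ∀ t e, Tendsto (fun s => a (s + e)) (𝓝[>] t) (𝓝 (a (t + e))) := by
    intro t e
    refine (hconv.tendsto_rightDeriv hcont (t + e)).comp ?_
    refine tendsto_nhdsWithin_iff.2 ⟨?_, ?_⟩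
    · exact ((continuous_id.add continuous_const).tendsto t).mono_left nhdsWithin_le_nhds
    · filter_upwards [self_mem_nhdsWithin] with s hs
      simpa using hs
  have hctend : ∀ t e, Tendsto (fun s => c (s + e)) (𝓝[>] t) (𝓝 (c (t + e))) := by
    intro t e
    have h1 : Tendsto (fun s => s + e) (𝓝[>] t) (𝓝 (t + e)) :=
      ((continuous_id.add continuous_const).tendsto t).mono_left nhdsWithin_le_nhds
    exact ((hcont.tendsto _).comp h1).sub (h1.mul (hatend t e))
  have hrel' : ∀ t d, c t ≠ 0 → c (t + d) * (a (t - d) * c t - c (t - d) * a t) +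
      c (t - d) * (a (t + d) * c t - c (t + d) * a t) = 0 := by
    intro t d hct
    have hfreq : ∃ᶠ s in 𝓝[>] t, DifferentiableAt ℝ N s ∧ DifferentiableAt ℝ N (s + d) ∧
        DifferentiableAt ℝ N (s - d) := by
      have h1 : ∀ᵐ s, DifferentiableAt ℝ N s ∧ DifferentiableAt ℝ N (s + d) ∧
          DifferentiableAt ℝ N (s - d) := by
        have h2 := (MeasureTheory.measurePreserving_add_right
          MeasureTheory.volume d).quasiMeasurePreserving.ae hae
        have h3 := (MeasureTheory.measurePreserving_add_right MeasureTheory.volume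
          (-d)).quasiMeasurePreserving.ae hae
        filter_upwards [hae, h2, h3] with s h4 h5 h6
        exact ⟨h4, h5, h6⟩
      have hd := MeasureTheory.Measure.dense_of_ae h1
      refine (nhdsGT_basis t).frequently_iff.2 fun b hb => ?_
      obtain ⟨s, hs, hs'⟩ := hd.exists_mem_open isOpen_Ioo (nonempty_Ioo.2 hb)
      exact ⟨s, hs', hs⟩
    have ha0 := hatend t 0
    have hc0 := hctend t 0
    simp only [add_zero] at ha0 hc0
    have hap := hatend t d
    have hcp := hctend t d
    have ham := hatend t (-d)
    have hcm := hctend t (-d)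
    simp only [← sub_eq_add_neg] at ham hcm
    have hlim := (hcp.mul ((ham.mul hc0).sub (hcm.mul ha0))).add
      (hcm.mul ((hap.mul hc0).sub (hcp.mul ha0)))
    have hne : ∀ᶠ s in 𝓝[>] t, c s ≠ 0 := hc0.eventually_ne hct
    have := isClosed_singleton.mem_of_frequently_of_tendsto (s := {(0 : ℝ)})
      ((hfreq.and_eventually hne).mono fun s hs => ?_) hlim
    · simpa using this
    · obtain ⟨⟨h1, h2, h3⟩, h4⟩ := hs
      have := hrel s d h1 h2 h3 (by rw [hderiv s h1]; exact h4)
      rw [hderiv _ h1, hderiv _ h2, hderiv _ h3] at this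
      exact this
  have hcz : ∀ t, c t = 0 → t * a t = N t := fun t h => by simp only [hc] at h; linarith
  have hrefl : ∀ t d, c t ≠ 0 → c (t + d) = 0 → c (t - d) = 0 := by
    intro t d h1 h2
    have h3 := hrel' t d h1
    rw [h2] at h3
    have h4 : a (t + d) ≠ 0 := by
      intro h
      have := hcz _ h2
      rw [h, mul_zero] at this
      exact (hpos (t + d)).ne this
    have h5 : c (t - d) * (a (t + d) * c t) = 0 := by linarith
    simpa [h4, h1] using h5
  have hslope : ∀ t, |a t| ≤ 1 := by
    intro t
    have hle : ∀ s r, N s - N r ≤ |s - r| := fun s r => by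
      have := hlip.dist_le_mul s r
      rw [NNReal.coe_one, one_mul, Real.dist_eq, Real.dist_eq] at this
      exact (le_abs_self _).trans this
    rw [abs_le]
    constructor
    · have h1 := hconv.slope_le_leftDeriv_of_mem_interior (mem_univ (t - 1)) (hinter t)
        (by linarith)
      have h2 := h1.trans (hconv.leftDeriv_le_rightDeriv_of_mem_interior (hinter t))
      have h3 := hle (t - 1) t
      simp [slope_def_field] at h2 h3
      simp only [ha]
      linarith
    · have h1 := hconv.rightDeriv_le_slope_of_mem_interior (hinter t) (mem_univ (t + 1))
        (by linarith)
      have h3 := hle (t + 1) t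
      simp [slope_def_field] at h1 h3
      simp only [ha]
      linarith
  have hNabs : ∀ t, c t = 0 → N t = |t| := by
    intro t h
    refine le_antisymm ?_ (hlow t)
    rw [← hcz t h]
    calc t * a t ≤ |t * a t| := le_abs_self _
      _ = |t| * |a t| := abs_mul _ _
      _ ≤ |t| := mul_le_of_le_one_right (abs_nonneg _) (hslope t)
  have hc0 : c 0 ≠ 0 := by simpa [hc] using (hpos 0).ne'
  have hcne : ∀ t, c t ≠ 0 := by
    intro t ht
    have hhalf : ∀ n : ℕ, c (t / 2 ^ n) = 0 := by
      intro n
      induction n with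
      | zero => simpa using ht
      | succ n ih =>
        by_contra h
        have := hrefl _ (t / 2 ^ (n + 1)) h (by
          rw [show t / 2 ^ (n + 1) + t / 2 ^ (n + 1) = t / 2 ^ n by
            rw [pow_succ]; field_simp; norm_num]
          exact ih)
        rw [sub_self] at this
        exact hc0 this
    have hl : Tendsto (fun n : ℕ => t / 2 ^ n) atTop (𝓝 0) := by
      have := (tendsto_pow_atTop_nhds_zero_of_lt_one (r := (1 / 2 : ℝ)) (by norm_num)
        (by norm_num)).const_mul t
      simpa [div_eq_mul_inv] using this
    have h1 := (hcont.tendsto 0).comp hl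
    have h2 := (continuous_abs.tendsto (0 : ℝ)).comp hl
    have h3 := tendsto_nhds_unique h1 (h2.congr fun n => (hNabs _ (hhalf n)).symm)
    rw [abs_zero] at h3
    exact (hpos 0).ne' h3
  obtain ⟨α, β, hφ⟩ := exists_affine_of_jensen (φ := fun t => a t / c t) (by
    intro t d
    have h1 := hrel' t d (hcne t)
    have h2 := hcne t
    have h3 := hcne (t + d)
    have h4 := hcne (t - d)
    field_simp
    linarith) (by
    have h1 := hatend 0 0
    have h2 := hctend 0 0
    simp only [add_zero] at h1 h2
    exact h1.div h2 hc0)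
  have hφ' : ∀ t, a t = (α * t + β) * c t := fun t => by
    rw [← hφ t]; have := hcne t; field_simp
  have hcQ : ∀ t, c t * (1 + β * t + α * t ^ 2) = N t := by
    intro t
    have : c t + t * a t = N t := by simp [hc]
    rw [hφ'] at this
    linarith
  have hcpos : ∀ t, 0 < c t := by
    intro t
    refine lt_of_le_of_ne ?_ (hcne t).symm
    have : t * a t ≤ N t := by
      refine le_trans ?_ (hlow t)
      calc t * a t ≤ |t * a t| := le_abs_self _
        _ = |t| * |a t| := abs_mul _ _
        _ ≤ |t| := mul_le_of_le_one_right (abs_nonneg _) (hslope t)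
    simp only [hc]; linarith
  have hQ : ∀ t, 0 < 1 + β * t + α * t ^ 2 := fun t =>
    pos_of_mul_pos_right (by rw [hcQ]; exact hpos t) (hcpos t).le
  refine sq_eq_of_rightDeriv_eq hcont hlow hup hpos hQ fun t => ?_
  convert had t using 1
  rw [hφ', ← hcQ t, ← mul_assoc, mul_div_cancel_right₀ _ (hQ t).ne']

section NormDerivative

variable {X : Type*} [NormedAddCommGroup X] [NormedSpace ℝ X]

/-- The norm is Fréchet differentiable at `z`. -/
abbrev NormSmoothAt (z : X) : Prop := DifferentiableAt ℝ (fun x : X => ‖x‖) z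

/-- The Fréchet derivative of the norm at `z`. -/
noncomputable abbrev normDeriv (z : X) : X →L[ℝ] ℝ := fderiv ℝ (fun x : X => ‖x‖) z

theorem NormSmoothAt.smul {z : X} (h : NormSmoothAt z) {t : ℝ} (ht : t ≠ 0) :
    NormSmoothAt (t • z) :=
  (differentiableAt_norm_smul ht).1 h

theorem NormSmoothAt.neg {z : X} (h : NormSmoothAt z) : NormSmoothAt (-z) := by
  simpa using h.smul (t := -1) (by norm_num)

theorem normDeriv_neg (z : X) : normDeriv (-z) = -normDeriv z := by
  simpa using fderiv_norm_smul_neg (x := z) (t := -1) (by norm_num)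

theorem NormSmoothAt.ne_zero [Nontrivial X] {z : X} (h : NormSmoothAt z) : z ≠ 0 := by
  rintro rfl
  exact not_differentiableAt_norm_zero X h

theorem abs_normDeriv_apply_le (z v : X) : |normDeriv z v| ≤ ‖v‖ := by
  have h := (normDeriv z).le_of_opNorm_le
    (norm_fderiv_le_of_lipschitz ℝ (x₀ := z) lipschitzWith_one_norm) v
  simpa using h

theorem dense_normSmoothAt [FiniteDimensional ℝ X] {ι : Type*} [Finite ι] (s : ι → X) :
    Dense {z : X | ∀ i, NormSmoothAt (z + s i)} := by
  borelize X
  let μ : MeasureTheory.Measure X := MeasureTheory.Measure.addHaar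
  have h : ∀ᵐ z ∂μ, ∀ i, NormSmoothAt (z + s i) := by
    rw [MeasureTheory.ae_all_iff]
    intro i
    exact (MeasureTheory.measurePreserving_add_right μ (s i)).quasiMeasurePreserving.ae
      (ae_differentiableAt_norm (μ := μ))
  exact MeasureTheory.Measure.dense_of_ae h

theorem exists_normSmoothAt [FiniteDimensional ℝ X] : ∃ z : X, NormSmoothAt z := by
  obtain ⟨z, hz⟩ := (dense_normSmoothAt (X := X) (fun _ : Unit => 0)).nonempty
  exact ⟨z, by simpa using hz⟩

/-- In a plane, some point of smoothness `e₁` of norm one together with some `e₂` in the kernel of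
the derivative at `e₁` form a basis; `ω` is the second coordinate. -/
theorem exists_smooth_orthogonal_coordinates (hdim : Module.finrank ℝ X = 2) :
    ∃ (e₁ e₂ : X) (ω : X →L[ℝ] ℝ), NormSmoothAt e₁ ∧ ‖e₁‖ = 1 ∧ normDeriv e₁ e₁ = 1 ∧
      normDeriv e₁ e₂ = 0 ∧ ω e₁ = 0 ∧ ω e₂ = 1 ∧
      ∀ z, z = normDeriv e₁ z • e₁ + ω z • e₂ := by
  have : FiniteDimensional ℝ X := Module.finite_of_finrank_eq_succ hdim
  have : Nontrivial X := Module.nontrivial_of_finrank_pos (R := ℝ) (by omega)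
  obtain ⟨z, hz⟩ := exists_normSmoothAt (X := X)
  have hz0 := norm_ne_zero_iff.2 hz.ne_zero
  have h1 : NormSmoothAt (‖z‖⁻¹ • z) := hz.smul (inv_ne_zero hz0)
  set e₁ := ‖z‖⁻¹ • z with he₁
  have hn : ‖e₁‖ = 1 := by rw [he₁, norm_smul, norm_inv, norm_norm, inv_mul_cancel₀ hz0]
  have h11 : normDeriv e₁ e₁ = 1 := by rw [← hn]; exact h1.fderiv_norm_self
  have hker := LinearMap.ker_ne_bot_of_finrank_lt (f := (normDeriv e₁ : X →ₗ[ℝ] ℝ))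
    (by simp [hdim])
  obtain ⟨e₂, he₂, he₂0⟩ := (Submodule.ne_bot_iff _).1 hker
  have h12 : normDeriv e₁ e₂ = 0 := he₂
  have hli : LinearIndependent ℝ ![e₁, e₂] := by
    rw [LinearIndependent.pair_iff]
    intro a b hab
    have h := congrArg (normDeriv e₁) hab
    simp only [map_add, map_smul, h11, h12, map_zero, smul_eq_mul, mul_one, mul_zero,
      add_zero] at h
    subst h
    simpa [he₂0] using hab
  let b := basisOfLinearIndependentOfCardEqFinrank hli (by simp [hdim])
  have hb0 : b 0 = e₁ := by simp [b]
  have hb1 : b 1 = e₂ := by simp [b]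
  have hrepr : ∀ z, z = b.repr z 0 • e₁ + b.repr z 1 • e₂ := fun z => by
    conv_lhs => rw [← b.sum_repr z]
    rw [Fin.sum_univ_two, hb0, hb1]
  refine ⟨e₁, e₂, LinearMap.toContinuousLinearMap (b.coord 1), h1, hn, h11, h12, ?_, ?_, ?_⟩
  · simp [← hb0]
  · simp [← hb1]
  · intro z
    have h : normDeriv e₁ z = b.repr z 0 := by
      conv_lhs => rw [hrepr z]
      simp [h11, h12]
    rw [h]
    exact hrepr z

/-- If the norm is differentiable along the affine line `τ ↦ e₂ + τ • e₁` at `τ`, then it is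
Fréchet differentiable at the corresponding point. -/
theorem normSmoothAt_of_line {e₁ e₂ : X} {ε ω : X →L[ℝ] ℝ} (h11 : ε e₁ = 1) (h12 : ε e₂ = 0)
    (h21 : ω e₁ = 0) (h22 : ω e₂ = 1) (hz : ∀ z, z = ε z • e₁ + ω z • e₂) {τ : ℝ}
    (h : DifferentiableAt ℝ (fun t : ℝ => ‖e₂ + t • e₁‖) τ) : NormSmoothAt (e₂ + τ • e₁) := by
  have hω : ω (e₂ + τ • e₁) = 1 := by simp [h21, h22]
  have hε : ε (e₂ + τ • e₁) = τ := by simp [h11, h12]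
  have hne : ω (e₂ + τ • e₁) ≠ 0 := by rw [hω]; exact one_ne_zero
  have h1 : DifferentiableAt ℝ (fun z : X => ε z / ω z) (e₂ + τ • e₁) := by
    simp only [div_eq_mul_inv]
    exact ε.differentiableAt.mul (ω.differentiableAt.inv hne)
  have h2 : DifferentiableAt ℝ (fun t : ℝ => ‖e₂ + t • e₁‖)
      (ε (e₂ + τ • e₁) / ω (e₂ + τ • e₁)) := by rwa [hω, hε, div_one]
  have h3 : DifferentiableAt ℝ (fun z : X => ω z * ‖e₂ + (ε z / ω z) • e₁‖) (e₂ + τ • e₁) :=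
    ω.differentiableAt.mul
      (DifferentiableAt.comp (g := fun t : ℝ => ‖e₂ + t • e₁‖) (e₂ + τ • e₁) h2 h1)
  refine h3.congr_of_eventuallyEq ?_
  have hpos : ∀ᶠ z in 𝓝 (e₂ + τ • e₁), 0 < ω z :=
    ω.continuous.continuousAt.eventually_const_lt (by rw [hω]; exact one_pos)
  filter_upwards [hpos] with z hz0
  have : z = ω z • (e₂ + (ε z / ω z) • e₁) := by
    rw [smul_add, smul_smul, mul_div_cancel₀ _ hz0.ne', add_comm]
    exact hz z
  conv_lhs => rw [this]
  rw [norm_smul, Real.norm_of_nonneg hz0.le]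

theorem normDeriv_line_apply {e₁ e₂ : X} {ε ω : X →L[ℝ] ℝ}
    (hz : ∀ z, z = ε z • e₁ + ω z • e₂) {τ : ℝ} (h : NormSmoothAt (e₂ + τ • e₁)) (v : X) :
    normDeriv (e₂ + τ • e₁) v =
      ω v * (‖e₂ + τ • e₁‖ - τ * deriv (fun t : ℝ => ‖e₂ + t • e₁‖) τ) +
        ε v * deriv (fun t : ℝ => ‖e₂ + t • e₁‖) τ := by
  have h1 : normDeriv (e₂ + τ • e₁) e₁ = deriv (fun t : ℝ => ‖e₂ + t • e₁‖) τ := by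
    have hl : HasDerivAt (fun t : ℝ => e₂ + t • e₁) e₁ τ := by
      simpa using ((hasDerivAt_id τ).smul_const e₁).const_add e₂
    exact (HasFDerivAt.comp_hasDerivAt τ h.hasFDerivAt hl).deriv.symm
  have h2 : normDeriv (e₂ + τ • e₁) (e₂ + τ • e₁) = ‖e₂ + τ • e₁‖ := h.fderiv_norm_self
  rw [map_add, map_smul, h1, smul_eq_mul] at h2
  conv_lhs => rw [hz v]
  rw [map_add, map_smul, map_smul, h1, smul_eq_mul, smul_eq_mul,
    show normDeriv (e₂ + τ • e₁) e₂ = ‖e₂ + τ • e₁‖ -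
      τ * deriv (fun t : ℝ => ‖e₂ + t • e₁‖) τ by linarith]
  ring

/-- The linear algebra behind the rigidity of a parallelogram with both diagonals. -/
theorem harmonic_elimination {a c a₁ c₁ a₂ c₂ p q σ : ℝ} (hc : c ≠ 0)
    (hdet : c₁ * (a₂ * c - c₂ * a) + c₂ * (a₁ * c - c₁ * a) ≠ 0)
    (hg : p * c + q * a = 0) (hh : (σ + p) * c₁ + q * a₁ = 0)
    (hk : (σ - p) * c₂ - q * a₂ = 0) : σ = 0 ∧ p = 0 ∧ q = 0 := by
  have hq : q = 0 := by
    have : q * (c₁ * (a₂ * c - c₂ * a) + c₂ * (a₁ * c - c₁ * a)) = 0 := by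
      linear_combination c * c₂ * hh - c * c₁ * hk - 2 * c₁ * c₂ * hg
    exact (mul_eq_zero.1 this).resolve_right hdet
  subst hq
  have hp : p = 0 := by simpa [hc] using hg
  subst hp
  refine ⟨?_, rfl, rfl⟩
  by_contra hσ
  have h1 : c₁ = 0 := by simpa [hσ] using hh
  have h2 : c₂ = 0 := by simpa [hσ] using hk
  simp [h1, h2] at hdet

/-- In a non-Euclidean normed plane some parallelogram with both diagonals is rigid. -/
theorem exists_rigid_parallelogram (hdim : Module.finrank ℝ X = 2)
    (hnE : ∃ x y : X, ‖x + y‖ ^ 2 + ‖x - y‖ ^ 2 ≠ 2 * ‖x‖ ^ 2 + 2 * ‖y‖ ^ 2) :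
    ∃ x y : X, NormSmoothAt x ∧ NormSmoothAt y ∧ NormSmoothAt (x + y) ∧ NormSmoothAt (x - y) ∧
      (∀ z, normDeriv x z = 0 → normDeriv y z = 0 → z = 0) ∧
      ∀ s t, normDeriv x s = 0 → normDeriv y t = 0 → normDeriv (x + y) (s + t) = 0 →
        normDeriv (x - y) (s - t) = 0 → s = 0 ∧ t = 0 := by
  obtain ⟨e₁, e₂, ω, hs1, hn1, h11, h12, h21, h22, hz⟩ := exists_smooth_orthogonal_coordinates hdim
  by_contra hno
  set N : ℝ → ℝ := fun t => ‖e₂ + t • e₁‖ with hN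
  have hzero : ∀ z, normDeriv e₁ z = 0 → ω z = 0 → z = 0 := fun z h h' => by
    rw [hz z, h, h']; simp
  have hconv : ConvexOn ℝ univ N := by
    refine ⟨convex_univ, fun r _ s _ a b ha hb hab => ?_⟩
    have : e₂ + (a • r + b • s) • e₁ = a • (e₂ + r • e₁) + b • (e₂ + s • e₁) := by
      have h : e₂ = (a + b) • e₂ := by rw [hab, one_smul]
      conv_lhs => rw [h]
      simp only [smul_eq_mul]
      module
    simp only [hN, this]
    refine (norm_add_le _ _).trans ?_
    rw [norm_smul, norm_smul, Real.norm_of_nonneg ha, Real.norm_of_nonneg hb]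
    rfl
  have hlip : LipschitzWith 1 N := by
    refine LipschitzWith.of_dist_le_mul fun r s => ?_
    rw [NNReal.coe_one, one_mul, Real.dist_eq, Real.dist_eq]
    refine (abs_norm_sub_norm_le _ _).trans ?_
    rw [add_sub_add_left_eq_sub, ← sub_smul, norm_smul, hn1, mul_one, Real.norm_eq_abs]
  have hlow : ∀ t, |t| ≤ N t := fun t => by
    have := abs_normDeriv_apply_le e₁ (e₂ + t • e₁)
    simpa [h11, h12] using this
  have hup : ∀ t, N t ≤ |t| + ‖e₂‖ := fun t => by
    refine (norm_add_le _ _).trans ?_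
    rw [norm_smul, hn1, mul_one, Real.norm_eq_abs, add_comm]
  have hpos : ∀ t, 0 < N t := fun t => by
    refine norm_pos_iff.2 fun h => ?_
    have := congrArg ω h
    simp [h21, h22] at this
  obtain ⟨K, hK, hsq⟩ := sq_eq_of_harmonic hconv hlow hup hpos hlip (by
    intro t d ht htp htm hc
    rcases eq_or_ne d 0 with rfl | hd
    · simp only [add_zero, sub_zero]; ring
    by_contra hdet
    have hst := normSmoothAt_of_line h11 h12 h21 h22 hz ht
    have hsp := normSmoothAt_of_line h11 h12 h21 h22 hz htp
    have hsm := normSmoothAt_of_line h11 h12 h21 h22 hz htm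
    have hx : ∀ z, normDeriv (d • e₁) z = 0 → normDeriv e₁ z = 0 := by
      intro z h
      rw [normDeriv, fderiv_norm_smul] at h
      refine (mul_eq_zero.1 h).resolve_left ?_
      rcases hd.lt_or_gt with hd | hd <;> simp [hd]
    have hadd : d • e₁ + (e₂ + t • e₁) = e₂ + (t + d) • e₁ := by module
    have hsub : d • e₁ - (e₂ + t • e₁) = -(e₂ + (t - d) • e₁) := by module
    refine hno ⟨d • e₁, e₂ + t • e₁, hs1.smul hd, hst, hadd ▸ hsp, hsub ▸ hsm.neg, ?_, ?_⟩
    · intro z h1 h2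
      have h1 := hx z h1
      rw [normDeriv_line_apply hz hst, h1, zero_mul, add_zero] at h2
      exact hzero z h1 ((mul_eq_zero.1 h2).resolve_right hc)
    · intro u v hu hv huv hvu
      have hu := hx u hu
      rw [normDeriv_line_apply hz hst] at hv
      rw [hadd, normDeriv_line_apply hz hsp, map_add, map_add, hu, zero_add] at huv
      rw [hsub, normDeriv_neg, neg_apply, neg_eq_zero,
        normDeriv_line_apply hz hsm, map_sub, map_sub, hu, zero_sub, neg_mul,
        ← sub_eq_add_neg] at hvu
      obtain ⟨h1, h2, h3⟩ := harmonic_elimination hc hdet hv huv hvu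
      exact ⟨hzero u hu h1, hzero v h3 h2⟩)
  have hnorm : ∀ z, ‖z‖ ^ 2 = normDeriv e₁ z ^ 2 + K * ω z ^ 2 := by
    intro z
    rcases eq_or_ne (ω z) 0 with h | h
    · conv_lhs => rw [hz z, h]
      simp [norm_smul, hn1, h]
    · have : z = ω z • (e₂ + (normDeriv e₁ z / ω z) • e₁) := by
        rw [smul_add, smul_smul, mul_div_cancel₀ _ h, add_comm]
        exact hz z
      conv_lhs => rw [this]
      have h2 := hsq (normDeriv e₁ z / ω z)
      simp only [hN] at h2
      rw [norm_smul, mul_pow, h2, Real.norm_eq_abs, sq_abs]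
      field_simp
      ring
  obtain ⟨x, y, hxy⟩ := hnE
  apply hxy
  simp only [hnorm, map_add, map_sub]
  ring

end NormDerivative

section Stability

variable {X : Type*} [NormedAddCommGroup X] [NormedSpace ℝ X]

theorem mul_normDeriv_le {z : X} (h : NormSmoothAt z) (v : X) (t : ℝ) :
    t * normDeriv z v ≤ ‖z + t • v‖ - ‖z‖ := by
  have h1 := (le_abs_self _).trans (abs_normDeriv_apply_le z (z + t • v))
  rw [map_add, map_smul, show normDeriv z z = ‖z‖ from h.fderiv_norm_self, smul_eq_mul] at h1
  linarith

/-- The derivative of the norm is continuous on its domain of existence. -/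
theorem tendsto_normDeriv_apply {ι : Type*} {l : Filter ι} {z : ι → X} {z₀ : X}
    (hz : Tendsto z l (𝓝 z₀)) (h₀ : NormSmoothAt z₀) (hs : ∀ i, NormSmoothAt (z i)) (v : X) :
    Tendsto (fun i => normDeriv (z i) v) l (𝓝 (normDeriv z₀ v)) := by
  have upper : ∀ (v : X) (a : ℝ), normDeriv z₀ v < a → ∀ᶠ i in l, normDeriv (z i) v < a := by
    intro v a ha
    have hl : HasDerivAt (fun t : ℝ => z₀ + t • v) v 0 := by
      simpa using ((hasDerivAt_id (0 : ℝ)).smul_const v).const_add z₀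
    have hd : HasDerivAt (fun t : ℝ => ‖z₀ + t • v‖) (normDeriv z₀ v) 0 :=
      HasFDerivAt.comp_hasDerivAt 0 (by simpa using h₀.hasFDerivAt) hl
    have h1 := (hasDerivWithinAt_iff_tendsto_slope' (self_notMem_Ioi)).1
      (hd.hasDerivWithinAt (s := Ioi 0))
    obtain ⟨t, hta, ht⟩ := ((h1.eventually_lt_const ha).and self_mem_nhdsWithin).exists
    have ht : 0 < t := ht
    rw [slope_def_field, div_lt_iff₀ (by linarith)] at hta
    simp only [zero_smul, add_zero, sub_zero] at hta
    have h2 : Tendsto (fun i => ‖z i + t • v‖ - ‖z i‖) l (𝓝 (‖z₀ + t • v‖ - ‖z₀‖)) :=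
      (hz.add_const _).norm.sub hz.norm
    filter_upwards [h2.eventually_lt_const hta] with i hi
    have := (mul_normDeriv_le (hs i) v t).trans_lt hi
    rw [mul_comm] at this
    exact lt_of_mul_lt_mul_right this ht.le
  refine tendsto_order.2 ⟨fun a ha => ?_, fun a ha => upper v a ha⟩
  filter_upwards [upper (-v) (-a) (by simpa using ha)] with i hi
  simpa using hi

theorem tendsto_of_tendsto_apply [FiniteDimensional ℝ X] {ι : Type*} {l : Filter ι}
    {f : ι → X →L[ℝ] ℝ} {g : X →L[ℝ] ℝ} (h : ∀ x, Tendsto (fun i => f i x) l (𝓝 (g x))) :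
    Tendsto f l (𝓝 g) := by
  let b := Module.finBasis ℝ X
  have hrep : ∀ φ : X →L[ℝ] ℝ,
      φ = ∑ j, φ (b j) • LinearMap.toContinuousLinearMap (b.coord j) := by
    intro φ
    ext x
    have hx : φ x = φ (∑ j, b.repr x j • b j) := by rw [b.sum_repr]
    rw [hx, map_sum]
    simp [mul_comm]
  rw [hrep g, show f = fun i => ∑ j, f i (b j) • LinearMap.toContinuousLinearMap (b.coord j) from
    funext fun i => hrep (f i)]
  exact tendsto_finsetSum _ fun j _ => (h (b j)).smul_const _

variable {V : Type*}

/-- The edge functionals `a` of the graph `H` on the vertex set `S` have only constant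
infinitesimal motions. -/
def InfRigid (H : SimpleGraph V) (S : Finset V) (a : V → V → X →L[ℝ] ℝ) : Prop :=
  ∀ u : V → X, (∀ v ∈ S, ∀ w ∈ S, H.Adj v w → a v w (u v - u w) = 0) →
    ∀ v ∈ S, ∀ w ∈ S, u v = u w

open Classical in
/-- The motions of `H` on `S` as the kernel of a continuous linear map, normalized to vanish at `o`
and outside of `S`. -/
noncomputable def rigidityMap [Fintype V] (H : SimpleGraph V) (S : Finset V) (o : V)
    (a : V × V → X →L[ℝ] ℝ) : (V → X) →L[ℝ] (V × V → ℝ) × (V → X) :=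
  ContinuousLinearMap.prod
    (ContinuousLinearMap.pi fun p => if p.1 ∈ S ∧ p.2 ∈ S ∧ H.Adj p.1 p.2 then
      (a p).comp (ContinuousLinearMap.proj (R := ℝ) (φ := fun _ : V => X) p.1 -
        ContinuousLinearMap.proj (R := ℝ) (φ := fun _ : V => X) p.2) else 0)
    (ContinuousLinearMap.pi fun v => if v ∈ S ∧ v ≠ o then 0 else
      ContinuousLinearMap.proj (R := ℝ) (φ := fun _ : V => X) v)

theorem rigidityMap_injective_iff [Fintype V] {H : SimpleGraph V} {S : Finset V} {o : V}
    (ho : o ∈ S) (a : V × V → X →L[ℝ] ℝ) :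
    Function.Injective (rigidityMap H S o a) ↔ InfRigid H S fun v w => a (v, w) := by
  classical
  rw [injective_iff_map_eq_zero]
  have key : ∀ u : V → X, rigidityMap H S o a u = 0 ↔
      (∀ v ∈ S, ∀ w ∈ S, H.Adj v w → a (v, w) (u v - u w) = 0) ∧
        ∀ v, ¬(v ∈ S ∧ v ≠ o) → u v = 0 := by
    intro u
    simp only [rigidityMap, ContinuousLinearMap.prod_apply, Prod.mk_eq_zero, funext_iff,
      Prod.forall, ContinuousLinearMap.pi_apply, Pi.zero_apply]
    refine and_congr ⟨fun h v hv w hw hvw => ?_, fun h v w => ?_⟩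
      ⟨fun h v hv => ?_, fun h v => ?_⟩
    · simpa [hv, hw, hvw] using h v w
    · split_ifs with hvw
      · simpa using h v hvw.1 w hvw.2.1 hvw.2.2
      · rfl
    · simpa [if_neg hv] using h v
    · split_ifs with hv
      · rfl
      · simpa using h v hv
  constructor
  · intro hinj u hu
    have h0 : ∀ v ∈ S, u v - u o = 0 := by
      have h := hinj (fun v => if v ∈ S then u v - u o else 0) ((key _).2 ⟨?_, ?_⟩)
      · intro v hv
        simpa [hv] using congrFun h v
      · intro v hv w hw hvw
        simpa [hv, hw] using hu v hv w hw hvw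
      · intro v hv
        by_cases hvS : v ∈ S
        · have : v = o := by by_contra h; exact hv ⟨hvS, h⟩
          simp [this]
        · simp [hvS]
    intro v hv w hw
    rw [sub_eq_zero.1 (h0 v hv), sub_eq_zero.1 (h0 w hw)]
  · intro h u hu
    obtain ⟨h1, h2⟩ := (key u).1 hu
    ext v
    by_cases hv : v ∈ S
    · rw [h u h1 v hv o ho]
      exact h2 o (by simp)
    · exact h2 v fun h => hv h.1

theorem continuous_rigidityMap [Fintype V] [FiniteDimensional ℝ X] (H : SimpleGraph V)
    (S : Finset V) (o : V) :
    Continuous (rigidityMap (X := X) H S o) := by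
  classical
  refine continuous_clm_apply.2 fun u => ?_
  have heq : ∀ a : V × V → X →L[ℝ] ℝ, rigidityMap H S o a u =
      (fun p => if p.1 ∈ S ∧ p.2 ∈ S ∧ H.Adj p.1 p.2 then a p (u p.1 - u p.2) else 0,
        fun v => if v ∈ S ∧ v ≠ o then 0 else u v) := by
    intro a
    refine Prod.ext (funext fun p => ?_) (funext fun v => ?_)
    · by_cases hp : p.1 ∈ S ∧ p.2 ∈ S ∧ H.Adj p.1 p.2 <;> simp [rigidityMap, hp]
    · by_cases hv : v ∈ S ∧ v ≠ o <;> simp [rigidityMap, hv]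
  simp only [heq]
  refine Continuous.prodMk (continuous_pi fun p => ?_) continuous_const
  by_cases hp : p.1 ∈ S ∧ p.2 ∈ S ∧ H.Adj p.1 p.2
  · simp only [if_pos hp]
    fun_prop
  · simp only [if_neg hp]
    exact continuous_const

/-- Infinitesimal rigidity is an open condition on the edge functionals. -/
theorem InfRigid.eventually [Fintype V] [FiniteDimensional ℝ X] {H : SimpleGraph V} {S : Finset V}
    {a : V → V → X →L[ℝ] ℝ} (h : InfRigid H S a) {ι : Type*} {l : Filter ι}
    {f : ι → V → V → X →L[ℝ] ℝ}
    (hf : ∀ v ∈ S, ∀ w ∈ S, v ≠ w → ∀ x, Tendsto (fun i => f i v w x) l (𝓝 (a v w x))) :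
    ∀ᶠ i in l, InfRigid H S (f i) := by
  classical
  rcases S.eq_empty_or_nonempty with rfl | ⟨o, ho⟩
  · exact Eventually.of_forall fun i u _ v hv => absurd hv (Finset.notMem_empty v)
  let g : (V → V → X →L[ℝ] ℝ) → V × V → X →L[ℝ] ℝ := fun b p =>
    if p.1 ∈ S ∧ p.2 ∈ S ∧ p.1 ≠ p.2 then b p.1 p.2 else 0
  have hg : ∀ b, InfRigid H S (fun v w => g b (v, w)) ↔ InfRigid H S b := by
    intro b
    have : ∀ v ∈ S, ∀ w ∈ S, H.Adj v w → g b (v, w) = b v w := fun v hv w hw hvw => by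
      simp [g, hv, hw, hvw.ne]
    unfold InfRigid
    refine forall_congr' fun u => imp_congr_left ?_
    refine forall₂_congr fun v hv => forall₂_congr fun w hw => forall_congr' fun hvw => ?_
    simp only [this v hv w hw hvw]
  have htend : Tendsto (fun i => g (f i)) l (𝓝 (g a)) := by
    refine tendsto_pi_nhds.2 fun p => ?_
    by_cases hp : p.1 ∈ S ∧ p.2 ∈ S ∧ p.1 ≠ p.2
    · simp only [g, if_pos hp]
      exact tendsto_of_tendsto_apply (hf _ hp.1 _ hp.2.1 hp.2.2)
    · simp only [g, if_neg hp]
      exact tendsto_const_nhds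
  have hinj := (rigidityMap_injective_iff ho (g a)).2 ((hg a).2 h)
  have hopen : {L : (V → X) →L[ℝ] (V × V → ℝ) × (V → X) | Function.Injective L} ∈
      𝓝 (rigidityMap H S o (g a)) := ContinuousLinearMap.isOpen_injective.mem_nhds hinj
  filter_upwards [((continuous_rigidityMap H S o).tendsto _).comp htend hopen] with i hi
  exact (hg _).1 ((rigidityMap_injective_iff ho _).1 hi)

/-- `H` restricted to `S` has an infinitesimally rigid placement in `X` for which the norm is
differentiable at all differences of distinct points. -/
def RigidOn (X : Type*) [NormedAddCommGroup X] [NormedSpace ℝ X] (H : SimpleGraph V)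
    (S : Finset V) : Prop :=
  ∃ p : V → X, (∀ v ∈ S, ∀ w ∈ S, v ≠ w → NormSmoothAt (p v - p w)) ∧
    InfRigid H S fun v w => normDeriv (p v - p w)

/-- Shrinking the placement `r` of the cluster `A` to a point `c` near `q`: rigidity of the limiting
edge functionals implies rigidity. -/
theorem rigidOn_of_cluster [Fintype V] [DecidableEq V] [FiniteDimensional ℝ X]
    {H : SimpleGraph V} {S A : Finset V} {q r : V → X} {c : X}
    (hqc : ∀ w ∈ S, w ∉ A → NormSmoothAt (c - q w))
    (hq : ∀ v ∈ S, v ∉ A → ∀ w ∈ S, w ∉ A → v ≠ w → NormSmoothAt (q v - q w))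
    (hr : ∀ v ∈ A, ∀ w ∈ A, v ≠ w → NormSmoothAt (r v - r w))
    (h : InfRigid H S fun v w => if v ∈ A ∧ w ∈ A then normDeriv (r v - r w) else
      normDeriv ((if v ∈ A then c else q v) - (if w ∈ A then c else q w))) :
    RigidOn X H S := by
  let ε : ℕ → ℝ := fun n => 1 / ((n : ℝ) + 1)
  have hε : ∀ n, 0 < ε n := fun n => Nat.one_div_pos_of_nat
  have hε0 : Tendsto ε atTop (𝓝 0) := tendsto_one_div_add_atTop_nhds_zero_nat
  have hb : ∀ n, ∃ b : X, dist b c < ε n ∧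
      ∀ i : V × V, NormSmoothAt (b + (ε n • r i.1 - q i.2)) := fun n => by
    obtain ⟨b, hb, hb'⟩ := (dense_normSmoothAt fun i : V × V =>
      ε n • r i.1 - q i.2).exists_mem_open Metric.isOpen_ball
      (Metric.nonempty_ball.2 (hε n) : (Metric.ball c (ε n)).Nonempty)
    exact ⟨b, hb', hb⟩
  choose b hbc hbs using hb
  have hbt : Tendsto b atTop (𝓝 c) :=
    tendsto_iff_dist_tendsto_zero.2
      (squeeze_zero (fun _ => dist_nonneg) (fun n => (hbc n).le) hε0)
  let p : ℕ → V → X := fun n v => if v ∈ A then b n + ε n • r v else q v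
  have hin : ∀ n, ∀ v ∈ A, ∀ w ∈ A, p n v - p n w = ε n • (r v - r w) := by
    intro n v hv w hw
    simp only [p, if_pos hv, if_pos hw]
    module
  have hsmooth : ∀ n, ∀ v ∈ S, ∀ w ∈ S, v ≠ w → NormSmoothAt (p n v - p n w) := by
    intro n v hv w hw hvw
    by_cases hvA : v ∈ A <;> by_cases hwA : w ∈ A
    · rw [hin n v hvA w hwA]
      exact (hr v hvA w hwA hvw).smul (hε n).ne'
    · simp only [p, if_pos hvA, if_neg hwA]
      simpa [add_sub_assoc] using hbs n (v, w)
    · simp only [p, if_pos hwA, if_neg hvA]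
      rw [← neg_sub]
      simpa [add_sub_assoc] using (hbs n (w, v)).neg
    · simp only [p, if_neg hwA, if_neg hvA]
      exact hq v hv hvA w hw hwA hvw
  have hlim : ∀ v, Tendsto (fun n => p n v) atTop (𝓝 (if v ∈ A then c else q v)) := by
    intro v
    by_cases hv : v ∈ A
    · simp only [p, if_pos hv]
      simpa using hbt.add (hε0.smul_const (r v))
    · simp only [p, if_neg hv]
      exact tendsto_const_nhds
  have hev := h.eventually (l := atTop) (f := fun n v w => normDeriv (p n v - p n w)) (by
    intro v hv w hw hvw x
    by_cases hA : v ∈ A ∧ w ∈ A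
    · simp only [if_pos hA, hin _ v hA.1 w hA.2]
      refine tendsto_const_nhds.congr fun n => ?_
      rw [normDeriv, normDeriv, fderiv_norm_smul_pos (hε n)]
    · simp only [if_neg hA]
      refine tendsto_normDeriv_apply ((hlim v).sub (hlim w)) ?_
        (fun n => hsmooth n v hv w hw hvw) x
      by_cases hvA : v ∈ A <;> by_cases hwA : w ∈ A
      · exact absurd ⟨hvA, hwA⟩ hA
      · rw [if_pos hvA, if_neg hwA]
        exact hqc w hw hwA
      · rw [if_pos hwA, if_neg hvA, ← neg_sub]
        exact (hqc v hv hvA).neg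
      · rw [if_neg hwA, if_neg hvA]
        exact hq v hv hvA w hw hwA hvw)
  obtain ⟨n, hn⟩ := hev.exists
  exact ⟨p n, hsmooth n, hn⟩

end Stability

section Extension

variable {X : Type*} [NormedAddCommGroup X] [NormedSpace ℝ X]

theorem finrank_ker_eq_one (hdim : Module.finrank ℝ X = 2) {f : X →L[ℝ] ℝ} (hf : f ≠ 0) :
    Module.finrank ℝ (LinearMap.ker (f : X →ₗ[ℝ] ℝ)) = 1 := by
  have : FiniteDimensional ℝ X := Module.finite_of_finrank_eq_succ hdim
  have h := Module.Dual.finrank_ker_add_one_of_ne_zero (f := (f : X →ₗ[ℝ] ℝ))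
    (fun h => hf (ContinuousLinearMap.coe_injective h))
  omega

/-- Two nonzero functionals on a plane are independent or have the same kernel. -/
theorem independent_or_ker_le (hdim : Module.finrank ℝ X = 2) (f : X →L[ℝ] ℝ)
    {g : X →L[ℝ] ℝ} (hg : g ≠ 0) :
    (∀ z, f z = 0 → g z = 0 → z = 0) ∨ ∀ z, g z = 0 → f z = 0 := by
  by_contra! h
  obtain ⟨⟨z, hfz, hgz, hz⟩, w, hgw, hfw⟩ := h
  obtain ⟨c, hc⟩ := (finrank_eq_one_iff_of_nonzero'
    (⟨z, hgz⟩ : LinearMap.ker (g : X →ₗ[ℝ] ℝ)) (by simpa [Subtype.ext_iff] using hz)).1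
    (finrank_ker_eq_one hdim hg) ⟨w, hgw⟩
  have hc : c • z = w := congrArg Subtype.val hc
  exact hfw (by rw [← hc, map_smul, hfz, smul_zero])

theorem exists_independent_normDeriv (hdim : Module.finrank ℝ X = 2) {f : X →L[ℝ] ℝ}
    (hf : f ≠ 0) :
    ∃ h : X, NormSmoothAt h ∧ ∀ z, f z = 0 → normDeriv h z = 0 → z = 0 := by
  have : FiniteDimensional ℝ X := Module.finite_of_finrank_eq_succ hdim
  obtain ⟨⟨k, hfk⟩, hk, -⟩ := finrank_eq_one_iff'.1 (finrank_ker_eq_one hdim hf)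
  have hk : k ≠ 0 := by simpa using hk
  have hfk : f k = 0 := hfk
  have hk' := norm_pos_iff.2 hk
  obtain ⟨h, hh, hsm⟩ := (dense_normSmoothAt fun _ : Unit => (0 : X)).exists_mem_open
    Metric.isOpen_ball
    (Metric.nonempty_ball.2 (half_pos hk') : (Metric.ball k (‖k‖ / 2)).Nonempty)
  have hs : NormSmoothAt h := by simpa using hh ()
  rw [Metric.mem_ball, dist_eq_norm] at hsm
  refine ⟨h, hs, ?_⟩
  rcases independent_or_ker_le hdim (normDeriv h) hf with h1 | h1
  · exact fun z hz hz' => h1 z hz' hz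
  · exfalso
    have h2 := h1 k hfk
    have h3 := (le_abs_self _).trans (abs_normDeriv_apply_le h (h - k))
    rw [map_sub, show normDeriv h h = ‖h‖ from hs.fderiv_norm_self, h2] at h3
    have h4 := norm_sub_norm_le k h
    rw [norm_sub_rev] at h4
    linarith

theorem NormSmoothAt.normDeriv_ne_zero [Nontrivial X] {z : X} (hz : NormSmoothAt z) :
    normDeriv z ≠ 0 := by
  intro h
  have h1 : normDeriv z z = ‖z‖ := hz.fderiv_norm_self
  rw [h] at h1
  exact hz.ne_zero (norm_eq_zero.1 h1.symm)

theorem normDeriv_sub_comm_apply (a b z : X) :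
    normDeriv (a - b) z = -normDeriv (b - a) z := by
  rw [← neg_sub, normDeriv_neg, neg_apply]

theorem normDeriv_sub_comm_apply_sub (a b c d : X) :
    normDeriv (a - b) (c - d) = normDeriv (b - a) (d - c) := by
  rw [normDeriv_sub_comm_apply, ← map_neg, neg_sub]

variable {V : Type*}

/-- A new vertex `v` can be attached close to the vertex `x`, in direction `h₀`, whenever the
limiting edge functionals are rigid. -/
theorem rigidOn_insert_of_limit [Fintype V] [DecidableEq V] [FiniteDimensional ℝ X]
    {H : SimpleGraph V} {T : Finset V} {v x : V} {q : V → X} {h₀ : X} (hv : v ∉ T) (hx : x ∈ T)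
    (hq : ∀ a ∈ T, ∀ b ∈ T, a ≠ b → NormSmoothAt (q a - q b)) (hh : NormSmoothAt h₀)
    (h : ∀ u : V → X,
      (∀ a ∈ T, ∀ b ∈ T, H.Adj a b → normDeriv (q a - q b) (u a - u b) = 0) →
      (∀ w ∈ T, w ≠ x → H.Adj v w → normDeriv (q x - q w) (u v - u w) = 0) →
      (H.Adj v x → normDeriv h₀ (u v - u x) = 0) → ∀ a ∈ T, u a = u v) :
    RigidOn X H (insert v T) := by
  have hvx : v ≠ x := fun h => hv (h ▸ hx)
  have hT : ∀ w ∈ insert v T, w ≠ v → w ∈ T := fun w hw hwv =>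
    (Finset.mem_insert.1 hw).resolve_left hwv
  refine rigidOn_of_cluster (A := {v, x}) (c := q x) (q := q)
    (r := fun w => if w = v then h₀ else 0) ?_ ?_ ?_ ?_
  · intro w hw hwA
    simp only [Finset.mem_insert, Finset.mem_singleton, not_or] at hwA
    exact hq x hx w (hT w hw hwA.1) (Ne.symm hwA.2)
  · intro a ha haA b hb hbA hab
    simp only [Finset.mem_insert, Finset.mem_singleton, not_or] at haA hbA
    exact hq a (hT a ha haA.1) b (hT b hb hbA.1) hab
  · intro a ha b hb hab
    simp only [Finset.mem_insert, Finset.mem_singleton] at ha hb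
    rcases ha with rfl | rfl <;> rcases hb with rfl | rfl
    · exact absurd rfl hab
    · simpa [hvx.symm] using hh
    · simpa [hvx.symm] using hh.neg
    · exact absurd rfl hab
  · intro u hu
    have hmem : ∀ w ∈ T, w ∈ insert v T := fun w => Finset.mem_insert_of_mem
    have hcv : (if v ∈ ({v, x} : Finset V) then q x else q v) = q x := by simp
    have hc : ∀ w ∈ T, (if w ∈ ({v, x} : Finset V) then q x else q w) = q w := by
      intro w hw
      have hwv : w ≠ v := fun h => hv (h ▸ hw)
      by_cases hwx : w = x <;> simp [hwx, hwv]
    have hconst : ∀ a ∈ T, u a = u v := by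
      refine h u ?_ ?_ ?_
      · intro a ha b hb hab
        have := hu a (hmem a ha) b (hmem b hb) hab
        have hav : a ≠ v := fun h => hv (h ▸ ha)
        have hbv : b ≠ v := fun h => hv (h ▸ hb)
        beta_reduce at this
        rw [if_neg, hc a ha, hc b hb] at this
        · exact this
        · simp only [Finset.mem_insert, Finset.mem_singleton, hav, hbv, false_or]
          rintro ⟨rfl, rfl⟩
          exact hab.ne rfl
      · intro w hw hwx hvw
        have := hu v (Finset.mem_insert_self v T) w (hmem w hw) hvw
        have hwv : w ≠ v := fun h => hv (h ▸ hw)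
        beta_reduce at this
        rw [if_neg, hcv, hc w hw] at this
        · exact this
        · simp [hwv, hwx]
      · intro hadj
        have := hu v (Finset.mem_insert_self v T) x (hmem x hx) hadj
        simpa [hvx.symm] using this
    have hall : ∀ a ∈ insert v T, u a = u v := fun a ha => by
      by_cases hav : a = v
      · rw [hav]
      · exact hconst a (hT a ha hav)
    exact fun a ha b hb => (hall a ha).trans (hall b hb).symm

theorem RigidOn.insert_of_two_adj [Fintype V] [DecidableEq V]
    (hdim : Module.finrank ℝ X = 2) {H : SimpleGraph V} {T : Finset V} (hT : RigidOn X H T)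
    {v x y : V} (hv : v ∉ T) (hx : x ∈ T) (hy : y ∈ T) (hxy : x ≠ y) (hvx : H.Adj v x)
    (hvy : H.Adj v y) : RigidOn X H (insert v T) := by
  have : FiniteDimensional ℝ X := Module.finite_of_finrank_eq_succ hdim
  have : Nontrivial X := Module.nontrivial_of_finrank_eq_succ hdim
  obtain ⟨q, hq, hrig⟩ := hT
  obtain ⟨h₀, hh₀, hind⟩ := exists_independent_normDeriv hdim (hq x hx y hy hxy).normDeriv_ne_zero
  refine rigidOn_insert_of_limit hv hx hq hh₀ fun u hu hw hvx' a ha => ?_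
  have hc := hrig u hu
  rw [hc a ha x hx]
  have h1 := hw y hy hxy.symm hvy
  rw [hc y hy x hx] at h1
  exact (sub_eq_zero.1 (hind _ h1 (hvx' hvx))).symm

theorem rigidOn_insert_of_independent [Fintype V] [DecidableEq V]
    (hdim : Module.finrank ℝ X = 2) {H H' : SimpleGraph V} {T : Finset V} {v x y z : V}
    (hH : ∀ a ∈ T, ∀ b ∈ T, H'.Adj a b → H.Adj a b ∨ s(a, b) = s(x, y))
    {q : V → X} (hq : ∀ a ∈ T, ∀ b ∈ T, a ≠ b → NormSmoothAt (q a - q b))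
    (hrig : InfRigid H' T fun a b => normDeriv (q a - q b))
    (hv : v ∉ T) (hx : x ∈ T) (hy : y ∈ T) (hz : z ∈ T) (hxy : x ≠ y) (hxz : x ≠ z)
    (hvx : H.Adj v x) (hvy : H.Adj v y) (hvz : H.Adj v z)
    (hind : ∀ t, normDeriv (q x - q y) t = 0 → normDeriv (q x - q z) t = 0 → t = 0) :
    RigidOn X H (insert v T) := by
  have : FiniteDimensional ℝ X := Module.finite_of_finrank_eq_succ hdim
  refine rigidOn_insert_of_limit hv hx hq (hq x hx y hy hxy) fun u hu hw hvx' a ha => ?_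
  have h1 := hw y hy hxy.symm hvy
  have h2 := hvx' hvx
  have h3 : normDeriv (q x - q y) (u x - u y) = 0 := by
    rw [map_sub] at h1 h2 ⊢
    linarith
  have hc := hrig u fun a ha b hb hab => by
    rcases hH a ha b hb hab with h | h
    · exact hu a ha b hb h
    · rcases Sym2.eq_iff.1 h with ⟨rfl, rfl⟩ | ⟨rfl, rfl⟩
      · exact h3
      · rw [normDeriv_sub_comm_apply_sub, h3]
  have h4 := hw z hz hxz.symm hvz
  rw [hc z hz x hx] at h4
  rw [hc a ha x hx]
  exact (sub_eq_zero.1 (hind _ h2 h4)).symm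

theorem RigidOn.insert_of_three_adj [Fintype V] [DecidableEq V]
    (hdim : Module.finrank ℝ X = 2) {H H' : SimpleGraph V} {T : Finset V} (hT : RigidOn X H' T)
    {v x y z : V} (hH : ∀ a ∈ T, ∀ b ∈ T, H'.Adj a b → H.Adj a b ∨ s(a, b) = s(x, y))
    (hv : v ∉ T) (hx : x ∈ T) (hy : y ∈ T) (hz : z ∈ T) (hxy : x ≠ y) (hxz : x ≠ z) (hyz : y ≠ z)
    (hvx : H.Adj v x) (hvy : H.Adj v y) (hvz : H.Adj v z) : RigidOn X H (insert v T) := by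
  have : FiniteDimensional ℝ X := Module.finite_of_finrank_eq_succ hdim
  have : Nontrivial X := Module.nontrivial_of_finrank_eq_succ hdim
  obtain ⟨q, hq, hrig⟩ := hT
  have hzx := (hq z hz x hx hxz.symm).normDeriv_ne_zero
  have hzy := (hq z hz y hy hyz.symm).normDeriv_ne_zero
  rcases independent_or_ker_le hdim (normDeriv (q x - q y)) hzx with hind | hker
  · refine rigidOn_insert_of_independent hdim hH hq hrig hv hx hy hz hxy hxz hvx hvy hvz
      fun t h1 h2 => hind t h1 ?_
    rw [normDeriv_sub_comm_apply, h2, neg_zero]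
  rcases independent_or_ker_le hdim (normDeriv (q x - q y)) hzy with hind | hker'
  · refine rigidOn_insert_of_independent hdim (x := y) (y := x)
      (fun a ha b hb hab => by rw [Sym2.eq_swap (a := y)]; exact hH a ha b hb hab)
      hq hrig hv hy hx hz hxy.symm hyz hvy hvx hvz
      fun t h1 h2 => hind t ?_ ?_
    · rw [normDeriv_sub_comm_apply, h1, neg_zero]
    · rw [normDeriv_sub_comm_apply, h2, neg_zero]
  obtain ⟨h₀, hh₀, hind⟩ := exists_independent_normDeriv hdim hzx
  refine rigidOn_insert_of_limit hv hz hq hh₀ fun u hu hw hvz' a ha => ?_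
  have h1 := hw x hx hxz hvx
  have h2 := hker _ h1
  have h3 := hker' _ (hw y hy hyz hvy)
  have h4 : normDeriv (q x - q y) (u x - u y) = 0 := by
    rw [map_sub] at h2 h3 ⊢
    linarith
  have hc := hrig u fun a ha b hb hab => by
    rcases hH a ha b hb hab with h | h
    · exact hu a ha b hb h
    · rcases Sym2.eq_iff.1 h with ⟨rfl, rfl⟩ | ⟨rfl, rfl⟩
      · exact h4
      · rw [normDeriv_sub_comm_apply_sub, h4]
  rw [hc x hx z hz] at h1
  rw [hc a ha z hz]
  exact (sub_eq_zero.1 (hind _ h1 (hvz' hvz))).symm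

/-- Vertex substitution: blowing up the vertex `a` into the rigid graph on `A`. -/
theorem RigidOn.substitute [Fintype V] [DecidableEq V] [FiniteDimensional ℝ X]
    {H H' : SimpleGraph V} {S A : Finset V} {a : V} (hAS : A ⊆ S) (ha : a ∈ A)
    (hA : RigidOn X H A) (hS : RigidOn X H' (insert a (S \ A)))
    (hH : ∀ v ∈ S \ A, ∀ w ∈ S \ A, H'.Adj v w → H.Adj v w)
    (hHa : ∀ w ∈ S \ A, H'.Adj a w → ∃ b ∈ A, H.Adj b w) : RigidOn X H S := by
  obtain ⟨r, hr, hrig⟩ := hA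
  obtain ⟨q, hq, hqrig⟩ := hS
  have hmem : ∀ w ∈ S, w ∉ A → w ∈ insert a (S \ A) := fun w hw hwA =>
    Finset.mem_insert_of_mem (Finset.mem_sdiff.2 ⟨hw, hwA⟩)
  have hne : ∀ w, w ∉ A → a ≠ w := fun w hw h => hw (h ▸ ha)
  refine rigidOn_of_cluster (A := A) (c := q a) (q := q) (r := r)
    (fun w hw hwA => hq a (Finset.mem_insert_self _ _) w (hmem w hw hwA) (hne w hwA))
    (fun v hv hvA w hw hwA hvw => hq v (hmem v hv hvA) w (hmem w hw hwA) hvw) hr ?_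
  intro u hu
  have hcA := hrig u fun v hv w hw hvw => by
    simpa [hv, hw] using hu v (hAS hv) w (hAS hw) hvw
  have hcross : ∀ w ∈ S \ A, H'.Adj a w → normDeriv (q a - q w) (u a - u w) = 0 := by
    intro w hw haw
    obtain ⟨b, hb, hbw⟩ := hHa w hw haw
    obtain ⟨hwS, hwA⟩ := Finset.mem_sdiff.1 hw
    rw [hcA a ha b hb]
    simpa [hb, hwA] using hu b (hAS hb) w hwS hbw
  have hc := hqrig u fun v hv w hw hvw => by
    rcases Finset.mem_insert.1 hv with rfl | hv' <;>
      rcases Finset.mem_insert.1 hw with rfl | hw'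
    · exact absurd rfl hvw.ne
    · exact hcross w hw' hvw
    · rw [normDeriv_sub_comm_apply_sub, hcross v hv' hvw.symm]
    · obtain ⟨hvS, hvA⟩ := Finset.mem_sdiff.1 hv'
      obtain ⟨hwS, hwA⟩ := Finset.mem_sdiff.1 hw'
      simpa [hvA, hwA] using hu v hvS w hwS (hH v hv' w hw' hvw)
  have hall : ∀ v ∈ S, u v = u a := fun v hv => by
    by_cases hvA : v ∈ A
    · exact hcA v hvA a ha
    · exact hc v (hmem v hv hvA) a (Finset.mem_insert_self _ _)
  exact fun v hv w hw => (hall v hv).trans (hall w hw).symm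

theorem rigidOn_singleton (H : SimpleGraph V) (a : V) : RigidOn X H {a} := by
  refine ⟨fun _ => 0, fun v hv w hw hvw => ?_, fun u _ v hv w hw => ?_⟩
  · rw [Finset.mem_singleton] at hv hw
    exact absurd (hv.trans hw.symm) hvw
  · rw [Finset.mem_singleton] at hv hw
    rw [hv, hw]

/-- The complete graph on four vertices is rigid in every non-Euclidean normed plane. -/
theorem rigidOn_of_pairwise_adj_four [DecidableEq V] (hdim : Module.finrank ℝ X = 2)
    (hnE : ∃ x y : X, ‖x + y‖ ^ 2 + ‖x - y‖ ^ 2 ≠ 2 * ‖x‖ ^ 2 + 2 * ‖y‖ ^ 2)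
    {H : SimpleGraph V} {v x y z : V} (hvx : H.Adj v x) (hvy : H.Adj v y) (hvz : H.Adj v z)
    (hxy : H.Adj x y) (hxz : H.Adj x z) (hyz : H.Adj y z) :
    RigidOn X H {v, x, y, z} := by
  obtain ⟨a, b, ha, hb, hab, hab', hind, hpar⟩ := exists_rigid_parallelogram hdim hnE
  let p : V → X := fun w => if w = x then a else if w = y then b else if w = z then a + b else 0
  have hpv : p v = 0 := by simp [p, hvx.ne, hvy.ne, hvz.ne]
  have hpx : p x = a := by simp [p]
  have hpy : p y = b := by simp [p, hxy.ne']
  have hpz : p z = a + b := by simp [p, hxz.ne', hyz.ne']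
  refine ⟨p, ?_, ?_⟩
  · have hsym : ∀ s t, NormSmoothAt (p s - p t) → NormSmoothAt (p t - p s) := fun s t h => by
      rw [← neg_sub]
      exact h.neg
    have h1 : NormSmoothAt (p x - p v) := by simpa [hpx, hpv] using ha
    have h2 : NormSmoothAt (p y - p v) := by simpa [hpy, hpv] using hb
    have h3 : NormSmoothAt (p z - p v) := by simpa [hpz, hpv] using hab
    have h4 : NormSmoothAt (p x - p y) := by simpa [hpx, hpy] using hab'
    have h5 : NormSmoothAt (p z - p x) := by simpa [hpx, hpz] using hb
    have h6 : NormSmoothAt (p z - p y) := by simpa [hpy, hpz] using ha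
    intro s hs t ht hst
    simp only [Finset.mem_insert, Finset.mem_singleton] at hs ht
    rcases hs with rfl | rfl | rfl | rfl <;> rcases ht with rfl | rfl | rfl | rfl <;>
      first
      | exact absurd rfl hst
      | assumption
      | (apply hsym; assumption)
  · intro u hu
    have h1 : normDeriv a (u x - u v) = 0 := by
      simpa [hpx, hpv] using hu x (by simp) v (by simp) hvx.symm
    have h2 : normDeriv b (u y - u v) = 0 := by
      simpa [hpy, hpv] using hu y (by simp) v (by simp) hvy.symm
    have h3 : normDeriv (a + b) (u z - u v) = 0 := by
      simpa [hpz, hpv] using hu z (by simp) v (by simp) hvz.symm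
    have h4 : normDeriv (a - b) (u x - u y) = 0 := by
      simpa [hpx, hpy] using hu x (by simp) y (by simp) hxy
    have h5 : normDeriv b (u z - u x) = 0 := by
      simpa [hpx, hpz] using hu z (by simp) x (by simp) hxz.symm
    have h6 : normDeriv a (u z - u y) = 0 := by
      simpa [hpy, hpz] using hu z (by simp) y (by simp) hyz.symm
    have hz : u z - u v = (u x - u v) + (u y - u v) := by
      refine sub_eq_zero.1 (hind _ ?_ ?_)
      · rw [show u z - u v - (u x - u v + (u y - u v)) = (u z - u y) - (u x - u v) by abel,
          map_sub, h6, h1, sub_zero]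
      · rw [show u z - u v - (u x - u v + (u y - u v)) = (u z - u x) - (u y - u v) by abel,
          map_sub, h5, h2, sub_zero]
    rw [hz] at h3
    obtain ⟨hx, hy⟩ := hpar _ _ h1 h2 h3 (by rwa [sub_sub_sub_cancel_right])
    rw [hx, hy, add_zero, sub_eq_zero] at hz
    have hall : ∀ w ∈ ({v, x, y, z} : Finset V), u w = u v := by
      simp only [Finset.mem_insert, Finset.mem_singleton, forall_eq_or_imp, forall_eq]
      exact ⟨trivial, sub_eq_zero.1 hx, sub_eq_zero.1 hy, hz⟩
    exact fun s hs t ht => (hall s hs).trans (hall t ht).symm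

end Extension

section Sparsity

variable {V : Type*}

open Classical in
/-- The number of ordered pairs in `A × B` that are adjacent in `H`. -/
noncomputable def adjCount (H : SimpleGraph V) (A B : Finset V) : ℤ :=
  ∑ v ∈ A, ∑ w ∈ B, if H.Adj v w then 1 else 0

theorem adjCount_nonneg (H : SimpleGraph V) (A B : Finset V) : 0 ≤ adjCount H A B :=
  Finset.sum_nonneg fun _ _ => Finset.sum_nonneg fun _ _ => by split_ifs <;> simp

open Classical in
theorem adjCount_singleton_left (H : SimpleGraph V) (v : V) (A : Finset V) :
    adjCount H {v} A = (A.filter (H.Adj v)).card := by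
  simp [adjCount]

theorem adjCount_singleton_self (H : SimpleGraph V) (v : V) : adjCount H {v} {v} = 0 := by
  simp [adjCount]

/-- `(2,2)`-sparsity of the subgraph of `H` induced by `S`. -/
def SparseOn (H : SimpleGraph V) (S : Finset V) : Prop :=
  ∀ A ⊆ S, A.Nonempty → adjCount H A A ≤ 4 * A.card - 4

/-- The number of edges induced by `A` attains the `(2,2)`-sparsity bound. -/
def IsTight (H : SimpleGraph V) (A : Finset V) : Prop :=
  adjCount H A A = 4 * A.card - 4

theorem SparseOn.mono {H : SimpleGraph V} {S T : Finset V} (h : SparseOn H S) (hT : T ⊆ S) :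
    SparseOn H T := fun A hA => h A (hA.trans hT)

theorem IsTight.exists_adjCount_le_three {H : SimpleGraph V} {S : Finset V} (h : IsTight H S) :
    ∃ v ∈ S, adjCount H {v} S ≤ 3 := by
  by_contra! hall
  have h1 : ∑ v ∈ S, (4 : ℤ) ≤ ∑ v ∈ S, adjCount H {v} S :=
    Finset.sum_le_sum fun v hv => hall v hv
  have h2 : ∑ v ∈ S, adjCount H {v} S = adjCount H S S := by simp [adjCount]
  rw [h2, h] at h1
  simp at h1
  linarith

/-- The graph obtained from `H` by contracting `A` to the vertex `a`. -/
def contractTo (H : SimpleGraph V) (A : Finset V) (a : V) : SimpleGraph V :=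
  SimpleGraph.fromRel fun v w =>
    w ∉ A ∧ ((v ∉ A ∧ H.Adj v w) ∨ (v = a ∧ ∃ b ∈ A, H.Adj b w))

theorem contractTo_adj_of_notMem {H : SimpleGraph V} {A : Finset V} {a v w : V} (ha : a ∈ A)
    (hv : v ∉ A) (hw : w ∉ A) : (contractTo H A a).Adj v w ↔ H.Adj v w := by
  have hva : v ≠ a := fun h => hv (h ▸ ha)
  have hwa : w ≠ a := fun h => hw (h ▸ ha)
  simp only [contractTo, SimpleGraph.fromRel_adj, hv, hw, hva, hwa, H.adj_comm w v]
  simpa using fun h : H.Adj v w => h.ne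

theorem contractTo_adj_left {H : SimpleGraph V} {A : Finset V} {a w : V} (ha : a ∈ A)
    (hw : w ∉ A) : (contractTo H A a).Adj a w ↔ ∃ b ∈ A, H.Adj b w := by
  have hwa : a ≠ w := fun h => hw (h ▸ ha)
  simp [contractTo, SimpleGraph.fromRel_adj, hw, hwa, ha]

theorem adjCount_comm (H : SimpleGraph V) (A B : Finset V) : adjCount H A B = adjCount H B A := by
  classical
  unfold adjCount
  rw [Finset.sum_comm]
  exact Finset.sum_congr rfl fun v _ => Finset.sum_congr rfl fun w _ =>
    if_congr (H.adj_comm _ _) rfl rfl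

theorem adjCount_congr {H H' : SimpleGraph V} {A B : Finset V}
    (h : ∀ v ∈ A, ∀ w ∈ B, H.Adj v w ↔ H'.Adj v w) : adjCount H A B = adjCount H' A B := by
  classical exact
    Finset.sum_congr rfl fun v hv => Finset.sum_congr rfl fun w hw =>
      if_congr (h v hv w hw) rfl rfl

theorem isTight_singleton (H : SimpleGraph V) (v : V) : IsTight H {v} := by
  simp [IsTight, adjCount_singleton_self]

variable [DecidableEq V]

theorem adjCount_union_left (H : SimpleGraph V) {A B : Finset V} (h : Disjoint A B)
    (C : Finset V) : adjCount H (A ∪ B) C = adjCount H A C + adjCount H B C :=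
  Finset.sum_union h

theorem adjCount_union_right (H : SimpleGraph V) {A B : Finset V} (h : Disjoint A B)
    (C : Finset V) : adjCount H C (A ∪ B) = adjCount H C A + adjCount H C B := by
  rw [adjCount_comm, adjCount_union_left H h, adjCount_comm H A, adjCount_comm H B]

theorem adjCount_union_self (H : SimpleGraph V) {A B : Finset V} (h : Disjoint A B) :
    adjCount H (A ∪ B) (A ∪ B) = adjCount H A A + adjCount H B B + 2 * adjCount H A B := by
  rw [adjCount_union_left H h, adjCount_union_right H h, adjCount_union_right H h,
    adjCount_comm H B A]
  ring

theorem adjCount_insert_self (H : SimpleGraph V) {v : V} {A : Finset V} (h : v ∉ A) :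
    adjCount H (insert v A) (insert v A) = adjCount H A A + 2 * adjCount H {v} A := by
  rw [Finset.insert_eq, adjCount_union_self H (Finset.disjoint_singleton_left.2 h),
    adjCount_singleton_self, zero_add]

theorem adjCount_singleton_insert (H : SimpleGraph V) (v : V) (A : Finset V) :
    adjCount H {v} (insert v A) = adjCount H {v} A := by
  rw [adjCount_singleton_left, adjCount_singleton_left, Finset.filter_insert, if_neg (H.irrefl)]

theorem even_adjCount_self (H : SimpleGraph V) (A : Finset V) : Even (adjCount H A A) := by
  induction A using Finset.induction_on with
  | empty => simp [adjCount]
  | insert v A hv ih =>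
    rw [adjCount_insert_self H hv]
    exact ih.add (even_two_mul _)

/-- The number of edges induced by a set of vertices is supermodular. -/
theorem adjCount_supermodular (H : SimpleGraph V) (A B : Finset V) :
    adjCount H A A + adjCount H B B ≤
      adjCount H (A ∪ B) (A ∪ B) + adjCount H (A ∩ B) (A ∩ B) := by
  have hA := adjCount_union_self H (Finset.disjoint_sdiff_inter A B)
  have hB := adjCount_union_self H (Finset.disjoint_sdiff (s := A) (t := B))
  have hBi := adjCount_union_self H (Finset.disjoint_sdiff_inter B A)
  rw [Finset.sdiff_union_inter] at hA hBi
  rw [Finset.union_sdiff_self_eq_union] at hB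
  have hsplit := adjCount_union_left H (Finset.disjoint_sdiff_inter A B) (B \ A)
  rw [Finset.sdiff_union_inter] at hsplit
  rw [Finset.inter_comm B A, adjCount_comm H (B \ A) (A ∩ B)] at hBi
  have := adjCount_nonneg H (A \ B) (B \ A)
  linarith

open SimpleGraph in
theorem adjCount_sup_edge {H : SimpleGraph V} {x y : V} (hxy : x ≠ y) (h : ¬H.Adj x y)
    (A : Finset V) : adjCount (H ⊔ edge x y) A A =
      adjCount H A A + if x ∈ A ∧ y ∈ A then 2 else 0 := by
  classical
  have key : ∀ v w, @ite ℤ ((H ⊔ edge x y).Adj v w) (Classical.propDecidable _) 1 0 =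
      (if H.Adj v w then 1 else 0) + (if v = x then if w = y then 1 else 0 else 0) +
        if v = y then if w = x then 1 else 0 else 0 := by
    intro v w
    have h' : ¬H.Adj y x := fun h' => h h'.symm
    by_cases h1 : v = x
    · subst h1
      by_cases h2 : w = y
      · subst h2
        simp [edge_adj, h, hxy]
      · simp [edge_adj, h2, hxy]
    · by_cases h2 : v = y
      · subst h2
        by_cases h3 : w = x
        · subst h3
          simp [edge_adj, h', h1]
        · simp [edge_adj, h1, h3]
      · simp [edge_adj, h1, h2]
  unfold adjCount
  simp only [key, Finset.sum_add_distrib]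
  by_cases hx : x ∈ A <;> by_cases hy : y ∈ A <;> simp [hx, hy, Finset.sum_ite_eq', add_assoc]

theorem SparseOn.isTight_union {H : SimpleGraph V} {S A B : Finset V} (h : SparseOn H S)
    (hA : A ⊆ S) (hB : B ⊆ S) (hAt : IsTight H A) (hBt : IsTight H B)
    (hAB : (A ∩ B).Nonempty) : IsTight H (A ∪ B) := by
  have h1 := adjCount_supermodular H A B
  have h2 := h _ (Finset.union_subset hA hB) (hAB.mono Finset.inter_subset_union)
  have h3 := h _ (Finset.inter_subset_left.trans hA) hAB
  have h4 : ((A ∪ B).card : ℤ) + (A ∩ B).card = A.card + B.card := by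
    exact_mod_cast Finset.card_union_add_card_inter A B
  unfold IsTight at *
  linarith

theorem SparseOn.adjCount_singleton_le {H : SimpleGraph V} {S A : Finset V} {w : V}
    (h : SparseOn H S) (hA : insert w A ⊆ S) (hw : w ∉ A) (hAt : IsTight H A) :
    adjCount H {w} A ≤ 2 := by
  have h1 := h _ hA (Finset.insert_nonempty w A)
  rw [adjCount_insert_self H hw, hAt, Finset.card_insert_of_notMem hw] at h1
  push_cast at h1
  linarith

theorem IsTight.insert {H : SimpleGraph V} {A : Finset V} {w : V} (hA : IsTight H A)
    (hw : w ∉ A) (h : adjCount H {w} A = 2) : IsTight H (insert w A) := by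
  unfold IsTight at *
  rw [adjCount_insert_self H hw, hA, Finset.card_insert_of_notMem hw, h]
  push_cast
  ring

theorem two_le_adjCount {H : SimpleGraph V} {A : Finset V} {w x y : V} (hx : x ∈ A) (hy : y ∈ A)
    (hxy : x ≠ y) (hwx : H.Adj w x) (hwy : H.Adj w y) : 2 ≤ adjCount H {w} A := by
  classical
  rw [adjCount_singleton_left]
  have : ({x, y} : Finset V) ⊆ A.filter (H.Adj w) := by
    simp [Finset.insert_subset_iff, hx, hy, hwx, hwy]
  have := Finset.card_le_card this
  rw [Finset.card_pair hxy] at this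
  exact_mod_cast this

theorem three_le_adjCount {H : SimpleGraph V} {A : Finset V} {w x y z : V} (hx : x ∈ A)
    (hy : y ∈ A) (hz : z ∈ A) (hxy : x ≠ y) (hxz : x ≠ z) (hyz : y ≠ z) (hwx : H.Adj w x)
    (hwy : H.Adj w y) (hwz : H.Adj w z) : 3 ≤ adjCount H {w} A := by
  classical
  rw [adjCount_singleton_left]
  have : ({x, y, z} : Finset V) ⊆ A.filter (H.Adj w) := by
    simp [Finset.insert_subset_iff, hx, hy, hz, hwx, hwy, hwz]
  have := Finset.card_le_card this
  rw [Finset.card_eq_three.2 ⟨x, y, z, hxy, hxz, hyz, rfl⟩] at this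
  exact_mod_cast this

theorem adjCount_self_erase (H : SimpleGraph V) {S : Finset V} {v : V} (hv : v ∈ S) :
    adjCount H S S = adjCount H (S.erase v) (S.erase v) + 2 * adjCount H {v} S := by
  have h := adjCount_insert_self H (Finset.notMem_erase v S)
  have h' := adjCount_singleton_insert H v (S.erase v)
  rw [Finset.insert_erase hv] at h h'
  rw [h, h']

theorem SparseOn.two_le_adjCount {H : SimpleGraph V} {S : Finset V} (h : SparseOn H S)
    (hS : IsTight H S) (hcard : 2 ≤ S.card) {v : V} (hv : v ∈ S) : 2 ≤ adjCount H {v} S := by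
  have h1 := adjCount_self_erase H hv
  have h2 := Finset.card_erase_add_one hv
  have h3 := h _ (Finset.erase_subset v S) (Finset.card_pos.1 (by omega))
  unfold IsTight at hS
  zify at h2
  linarith

theorem IsTight.erase {H : SimpleGraph V} {S : Finset V} (hS : IsTight H S) {v : V} (hv : v ∈ S)
    (hd : adjCount H {v} S = 2) : IsTight H (S.erase v) := by
  have h1 := adjCount_self_erase H hv
  have h2 := Finset.card_erase_add_one hv
  unfold IsTight at *
  zify at h2
  linarith

open SimpleGraph in
theorem SparseOn.sup_edge {H : SimpleGraph V} {T : Finset V} {x y : V} (h : SparseOn H T)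
    (hxy : x ≠ y) (hadj : ¬H.Adj x y) (ht : ∀ A ⊆ T, x ∈ A → y ∈ A → ¬IsTight H A) :
    SparseOn (H ⊔ edge x y) T := by
  intro A hA hne
  rw [adjCount_sup_edge hxy hadj]
  have h1 := h A hA hne
  split_ifs with hm
  · obtain ⟨k, hk⟩ := even_adjCount_self H A
    have h2 := ht A hA hm.1 hm.2
    unfold IsTight at h2
    omega
  · linarith

open SimpleGraph in
theorem IsTight.sup_edge {H : SimpleGraph V} {S : Finset V} {v x y : V} (hS : IsTight H S)
    (hv : v ∈ S) (hd : adjCount H {v} S = 3) (hx : x ∈ S.erase v) (hy : y ∈ S.erase v)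
    (hxy : x ≠ y) (hadj : ¬H.Adj x y) : IsTight (H ⊔ edge x y) (S.erase v) := by
  have h1 := adjCount_self_erase H hv
  have h2 := Finset.card_erase_add_one hv
  unfold IsTight at *
  rw [adjCount_sup_edge hxy hadj, if_pos ⟨hx, hy⟩]
  zify at h2
  linarith

theorem adjCount_contractTo {H : SimpleGraph V} {A B : Finset V} {a : V} (ha : a ∈ A)
    (hAB : Disjoint A B) (hd : ∀ w ∈ B, adjCount H {w} A ≤ 1) :
    adjCount (contractTo H A a) (insert a B) (insert a B) =
      adjCount H (A ∪ B) (A ∪ B) - adjCount H A A := by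
  classical
  have hB : ∀ w ∈ B, w ∉ A := fun w hw hwA => Finset.disjoint_left.1 hAB hwA hw
  have haB : a ∉ B := fun h => hB a h ha
  rw [adjCount_insert_self _ haB, adjCount_union_self H hAB,
    adjCount_congr fun v hv w hw => contractTo_adj_of_notMem ha (hB v hv) (hB w hw)]
  have hcross : adjCount (contractTo H A a) {a} B = adjCount H A B := by
    rw [adjCount_comm H A B]
    simp only [adjCount, Finset.sum_singleton]
    refine Finset.sum_congr rfl fun w hw => ?_
    have h1 := hd w hw
    rw [adjCount_singleton_left] at h1
    have h2 : ∑ b ∈ A, (if H.Adj w b then (1 : ℤ) else 0) = (A.filter (H.Adj w)).card := by simp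
    rw [h2]
    simp only [contractTo_adj_left ha (hB w hw)]
    split_ifs with hex
    · obtain ⟨b, hb, hbw⟩ := hex
      have : 0 < (A.filter (H.Adj w)).card :=
        Finset.card_pos.2 ⟨b, Finset.mem_filter.2 ⟨hb, hbw.symm⟩⟩
      omega
    · rw [Finset.filter_false_of_mem fun b hb hwb => hex ⟨b, hb, hwb.symm⟩]
      simp
  rw [hcross]
  ring

theorem SparseOn.contractTo {H : SimpleGraph V} {S A : Finset V} {a : V} (h : SparseOn H S)
    (hAS : A ⊆ S) (ha : a ∈ A) (hA : IsTight H A) (hd : ∀ w ∈ S \ A, adjCount H {w} A ≤ 1) :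
    SparseOn (contractTo H A a) (insert a (S \ A)) := by
  intro B hB hne
  have hsub : ∀ w ∈ B, w ≠ a → w ∈ S \ A := fun w hw hwa =>
    (Finset.mem_insert.1 (hB hw)).resolve_left hwa
  by_cases haB : a ∈ B
  · have hdisj : Disjoint A (B.erase a) := by
      refine Finset.disjoint_right.2 fun w hw => ?_
      exact (Finset.mem_sdiff.1 (hsub w (Finset.mem_of_mem_erase hw) (Finset.ne_of_mem_erase hw))).2
    have h1 := adjCount_contractTo ha hdisj fun w hw =>
      hd w (hsub w (Finset.mem_of_mem_erase hw) (Finset.ne_of_mem_erase hw))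
    have h2 := h (A ∪ B.erase a) (Finset.union_subset hAS fun w hw =>
      (Finset.mem_sdiff.1 (hsub w (Finset.mem_of_mem_erase hw) (Finset.ne_of_mem_erase hw))).1)
      (Finset.Nonempty.mono Finset.subset_union_left ⟨a, ha⟩)
    rw [Finset.card_union_of_disjoint hdisj] at h2
    have h3 := Finset.card_erase_add_one haB
    rw [Finset.insert_erase haB] at h1
    unfold IsTight at hA
    zify at h3
    push_cast at h2
    linarith
  · have hB' : ∀ w ∈ B, w ∈ S \ A := fun w hw => hsub w hw fun h => haB (h ▸ hw)
    rw [adjCount_congr fun v hv w hw => contractTo_adj_of_notMem ha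
      (Finset.mem_sdiff.1 (hB' v hv)).2 (Finset.mem_sdiff.1 (hB' w hw)).2]
    exact h B (fun w hw => (Finset.mem_sdiff.1 (hB' w hw)).1) hne

theorem IsTight.contractTo {H : SimpleGraph V} {S A : Finset V} {a : V} (hS : IsTight H S)
    (hAS : A ⊆ S) (ha : a ∈ A) (hA : IsTight H A) (hd : ∀ w ∈ S \ A, adjCount H {w} A ≤ 1) :
    IsTight (contractTo H A a) (Insert.insert a (S \ A)) := by
  have h1 := adjCount_contractTo ha Finset.disjoint_sdiff hd
  rw [Finset.union_sdiff_of_subset hAS] at h1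
  have h2 := Finset.card_sdiff_add_card_eq_card hAS
  unfold IsTight at *
  have h3 : a ∉ S \ A := fun h => (Finset.mem_sdiff.1 h).2 ha
  rw [h1, Finset.card_insert_of_notMem h3]
  zify at h2
  push_cast
  linarith

theorem isTight_of_pairwise_adj_four {H : SimpleGraph V} {v x y z : V} (hvx : H.Adj v x)
    (hvy : H.Adj v y) (hvz : H.Adj v z) (hxy : H.Adj x y) (hxz : H.Adj x z) (hyz : H.Adj y z) :
    IsTight H {v, x, y, z} := by
  have hv : v ∉ ({x, y, z} : Finset V) := by simp [hvx.ne, hvy.ne, hvz.ne]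
  have hx : x ∉ ({y, z} : Finset V) := by simp [hxy.ne, hxz.ne]
  have hy : y ∉ ({z} : Finset V) := by simp [hyz.ne]
  unfold IsTight
  rw [adjCount_insert_self H hv, adjCount_insert_self H hx, adjCount_insert_self H hy,
    adjCount_singleton_self, Finset.card_insert_of_notMem hv, Finset.card_insert_of_notMem hx,
    Finset.card_insert_of_notMem hy, Finset.card_singleton]
  have h1 : adjCount H {y} {z} = 1 := by
    simp [adjCount_singleton_left, Finset.filter_singleton, hyz]
  have h2 : adjCount H {x} {y, z} = 2 := by
    simp [adjCount, Finset.sum_pair hyz.ne, hxy, hxz]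
  have h3 : adjCount H {v} {x, y, z} = 3 := by
    unfold adjCount
    rw [Finset.sum_singleton, Finset.sum_insert hx, Finset.sum_pair hyz.ne]
    simp [hvx, hvy, hvz]
  rw [h1, h2, h3]
  norm_num

end Sparsity

section Rigidity

variable {V : Type*}

open SimpleGraph in
/-- A degree three vertex of a tight sparse graph either can be removed by an inverse
`1`-extension, or lies in a copy of the complete graph on four vertices. -/
theorem SparseOn.exists_sup_edge_or_pairwise_adj [DecidableEq V] {H : SimpleGraph V}
    {S : Finset V} {v x y z : V} (h : SparseOn H S) (hv : v ∈ S) (hx : x ∈ S.erase v)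
    (hy : y ∈ S.erase v) (hz : z ∈ S.erase v) (hxy : x ≠ y) (hxz : x ≠ z) (hyz : y ≠ z)
    (hvx : H.Adj v x) (hvy : H.Adj v y) (hvz : H.Adj v z) :
    (¬H.Adj x y ∧ SparseOn (H ⊔ edge x y) (S.erase v)) ∨
    (¬H.Adj x z ∧ SparseOn (H ⊔ edge x z) (S.erase v)) ∨
    (¬H.Adj y z ∧ SparseOn (H ⊔ edge y z) (S.erase v)) ∨
    (H.Adj x y ∧ H.Adj x z ∧ H.Adj y z) := by
  have hT := h.mono (Finset.erase_subset v S)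
  have hno : ∀ A ⊆ S.erase v, IsTight H A → x ∈ A → y ∈ A → z ∈ A → False := by
    intro A hA hAt hxA hyA hzA
    have hvA : v ∉ A := fun hvA => (Finset.mem_erase.1 (hA hvA)).1 rfl
    have h1 := h.adjCount_singleton_le
      (Finset.insert_subset hv (hA.trans (Finset.erase_subset v S))) hvA hAt
    have h2 := three_le_adjCount hxA hyA hzA hxy hxz hyz hvx hvy hvz
    omega
  have hadd : ∀ A ⊆ S.erase v, IsTight H A → ∀ a b c : V, c ∈ S.erase v → a ∈ A → b ∈ A →
      a ≠ b → H.Adj c a → H.Adj c b →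
      ∃ B ⊆ S.erase v, IsTight H B ∧ A ⊆ B ∧ c ∈ B := by
    intro A hA hAt a b c hc haA hbA hab hca hcb
    by_cases hcA : c ∈ A
    · exact ⟨A, hA, hAt, Finset.Subset.rfl, hcA⟩
    · have hsub := Finset.insert_subset hc hA
      have h1 := hT.adjCount_singleton_le hsub hcA hAt
      have h2 := _root_.two_le_adjCount haA hbA hab hca hcb
      exact ⟨insert c A, hsub, hAt.insert hcA (le_antisymm h1 h2), Finset.subset_insert c A,
        Finset.mem_insert_self c A⟩
  have hpair : ∀ a b : V, a ≠ b → H.Adj a b ∨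
      (¬H.Adj a b ∧ SparseOn (H ⊔ edge a b) (S.erase v)) ∨
      (∃ A ⊆ S.erase v, IsTight H A ∧ a ∈ A ∧ b ∈ A) := by
    intro a b hab
    by_cases hadj : H.Adj a b
    · exact Or.inl hadj
    by_cases ht : ∃ A ⊆ S.erase v, IsTight H A ∧ a ∈ A ∧ b ∈ A
    · exact Or.inr (Or.inr ht)
    · exact Or.inr (Or.inl ⟨hadj, hT.sup_edge hab hadj fun A hA haA hbA hAt =>
        ht ⟨A, hA, hAt, haA, hbA⟩⟩)
  have hunion : ∀ A ⊆ S.erase v, ∀ B ⊆ S.erase v, IsTight H A → IsTight H B →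
      (A ∩ B).Nonempty → x ∈ A ∪ B → y ∈ A ∪ B → z ∈ A ∪ B → False :=
    fun A hA B hB hAt hBt hAB => hno _ (Finset.union_subset hA hB)
      (hT.isTight_union hA hB hAt hBt hAB)
  rcases hpair x y hxy with h1 | h1 | ⟨A, hA, hAt, hA1, hA2⟩ <;>
  rcases hpair x z hxz with h2 | h2 | ⟨B, hB, hBt, hB1, hB2⟩ <;>
  rcases hpair y z hyz with h3 | h3 | ⟨C, hC, hCt, hC1, hC2⟩ <;>
  first
  | exact Or.inl h1
  | exact Or.inr (Or.inl h2)
  | exact Or.inr (Or.inr (Or.inl h3))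
  | exact Or.inr (Or.inr (Or.inr ⟨h1, h2, h3⟩))
  | exact (hunion A hA B hB hAt hBt ⟨x, by simp [*]⟩ (by simp [*]) (by simp [*])
      (by simp [*])).elim
  | exact (hunion A hA C hC hAt hCt ⟨y, by simp [*]⟩ (by simp [*]) (by simp [*])
      (by simp [*])).elim
  | exact (hunion B hB C hC hBt hCt ⟨z, by simp [*]⟩ (by simp [*]) (by simp [*])
      (by simp [*])).elim
  | (obtain ⟨D, hD, hDt, hAD, hcD⟩ := hadd A hA hAt x y z hz hA1 hA2 hxy h2.symm h3.symm
     exact (hno D hD hDt (hAD hA1) (hAD hA2) hcD).elim)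
  | (obtain ⟨D, hD, hDt, hAD, hcD⟩ := hadd B hB hBt x z y hy hB1 hB2 hxz h1.symm h3
     exact (hno D hD hDt (hAD hB1) hcD (hAD hB2)).elim)
  | (obtain ⟨D, hD, hDt, hAD, hcD⟩ := hadd C hC hCt y z x hx hC1 hC2 hyz h1 h2
     exact (hno D hD hDt hcD (hAD hC1) (hAD hC2)).elim)

/-- A maximal proper tight subset absorbs at most one edge from each outside vertex, provided that
all degrees are at least three. -/
theorem SparseOn.exists_proper_tight [DecidableEq V] {H : SimpleGraph V} {S A₀ : Finset V}
    (h : SparseOn H S) (hdeg : ∀ w ∈ S, 3 ≤ adjCount H {w} S) (hA₀ : A₀ ⊂ S)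
    (hcard : 2 ≤ A₀.card) (ht : IsTight H A₀) :
    ∃ A ⊂ S, 2 ≤ A.card ∧ IsTight H A ∧ ∀ w ∈ S \ A, adjCount H {w} A ≤ 1 := by
  classical
  obtain ⟨A, hA, hmax⟩ := Finset.exists_max_image
    (S.ssubsets.filter fun A => 2 ≤ A.card ∧ IsTight H A) Finset.card
    ⟨A₀, by simp [hA₀, hcard, ht]⟩
  simp only [Finset.mem_filter, Finset.mem_ssubsets] at hA hmax
  obtain ⟨hAS, hAc, hAt⟩ := hA
  refine ⟨A, hAS, hAc, hAt, fun w hw => ?_⟩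
  obtain ⟨hwS, hwA⟩ := Finset.mem_sdiff.1 hw
  by_contra! hlt
  have hsub := Finset.insert_subset hwS hAS.subset
  have h2 := le_antisymm (h.adjCount_singleton_le hsub hwA hAt) hlt
  have hins := hAt.insert hwA h2
  have hlt' := Finset.card_lt_card (Finset.ssubset_insert hwA)
  by_cases heq : insert w A = S
  · have h3 := hdeg w hwS
    rw [← heq, adjCount_singleton_insert, h2] at h3
    omega
  · have := hmax (insert w A) ⟨(hsub.ssubset_of_ne heq), by omega, hins⟩
    omega

variable {X : Type*} [NormedAddCommGroup X] [NormedSpace ℝ X]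

open SimpleGraph in
theorem RigidOn.of_erase_sup_edge [Fintype V] [DecidableEq V] (hdim : Module.finrank ℝ X = 2)
    {H : SimpleGraph V} {S : Finset V} {v x y z : V} (hv : v ∈ S) (hx : x ∈ S.erase v)
    (hy : y ∈ S.erase v) (hz : z ∈ S.erase v) (hxy : x ≠ y) (hxz : x ≠ z) (hyz : y ≠ z)
    (hvx : H.Adj v x) (hvy : H.Adj v y) (hvz : H.Adj v z)
    (h : RigidOn X (H ⊔ edge x y) (S.erase v)) : RigidOn X H S := by
  rw [← Finset.insert_erase hv]
  refine h.insert_of_three_adj hdim (fun a _ b _ hab => ?_) (Finset.notMem_erase v S) hx hy hz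
    hxy hxz hyz hvx hvy hvz
  rw [sup_adj, edge_adj] at hab
  rcases hab with hab | ⟨hab, -⟩
  · exact Or.inl hab
  · exact Or.inr (Sym2.eq_iff.2 (by tauto))

/-- Graphs that are sparse and tight are rigid in every non-Euclidean normed plane. -/
theorem rigidOn_of_isTight [Fintype V] [DecidableEq V] (hdim : Module.finrank ℝ X = 2)
    (hnE : ∃ x y : X, ‖x + y‖ ^ 2 + ‖x - y‖ ^ 2 ≠ 2 * ‖x‖ ^ 2 + 2 * ‖y‖ ^ 2)
    (S : Finset V) : ∀ H : SimpleGraph V, S.Nonempty → SparseOn H S → IsTight H S →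
      RigidOn X H S := by
  classical
  have : FiniteDimensional ℝ X := Module.finite_of_finrank_eq_succ hdim
  induction S using Finset.strongInduction with
  | H S ih =>
  intro H hne hsp ht
  by_cases hcard : S.card ≤ 1
  · obtain ⟨a, rfl⟩ := Finset.card_eq_one.1 (le_antisymm hcard hne.card_pos)
    exact rigidOn_singleton H a
  have hcard : 2 ≤ S.card := by omega
  have herase : ∀ v ∈ S, (S.erase v).Nonempty := fun v hv => by
    have := Finset.card_erase_add_one hv
    exact Finset.card_pos.1 (by omega)
  have hsub := fun v => Finset.erase_subset v S
  by_cases hdeg : ∀ w ∈ S, 3 ≤ adjCount H {w} S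
  · obtain ⟨v, hv, hle⟩ := ht.exists_adjCount_le_three
    have hd := le_antisymm hle (hdeg v hv)
    have hd' := hd
    rw [adjCount_singleton_left] at hd'
    obtain ⟨x, y, z, hxy, hxz, hyz, hN⟩ := Finset.card_eq_three.1
      (show (S.filter (H.Adj v)).card = 3 by exact_mod_cast hd')
    have hmem : ∀ w ∈ ({x, y, z} : Finset V), w ∈ S.erase v ∧ H.Adj v w := by
      intro w hw
      rw [← hN, Finset.mem_filter] at hw
      exact ⟨Finset.mem_erase.2 ⟨hw.2.ne', hw.1⟩, hw.2⟩
    obtain ⟨hx, hvx⟩ := hmem x (by simp)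
    obtain ⟨hy, hvy⟩ := hmem y (by simp)
    obtain ⟨hz, hvz⟩ := hmem z (by simp)
    have ihv := fun H' => ih _ (Finset.erase_ssubset hv) H' (herase v hv)
    rcases hsp.exists_sup_edge_or_pairwise_adj hv hx hy hz hxy hxz hyz hvx hvy hvz with
      ⟨hn, hs⟩ | ⟨hn, hs⟩ | ⟨hn, hs⟩ | ⟨axy, axz, ayz⟩
    · exact .of_erase_sup_edge hdim hv hx hy hz hxy hxz hyz hvx hvy hvz
        (ihv _ hs (ht.sup_edge hv hd hx hy hxy hn))
    · exact .of_erase_sup_edge hdim hv hx hz hy hxz hxy hyz.symm hvx hvz hvy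
        (ihv _ hs (ht.sup_edge hv hd hx hz hxz hn))
    · exact .of_erase_sup_edge hdim hv hy hz hx hyz hxy.symm hxz.symm hvy hvz hvx
        (ihv _ hs (ht.sup_edge hv hd hy hz hyz hn))
    have hK : ({v, x, y, z} : Finset V) ⊆ S := by
      simp [Finset.insert_subset_iff, hv, hsub v hx, hsub v hy, hsub v hz]
    by_cases hKS : ({v, x, y, z} : Finset V) = S
    · rw [← hKS]
      exact rigidOn_of_pairwise_adj_four hdim hnE hvx hvy hvz axy axz ayz
    obtain ⟨A, hAS, hAc, hAt, hAd⟩ := hsp.exists_proper_tight hdeg (hK.ssubset_of_ne hKS)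
      (by
        refine le_trans (Finset.card_pair hvx.ne).ge (Finset.card_le_card ?_)
        simp [Finset.insert_subset_iff])
      (isTight_of_pairwise_adj_four hvx hvy hvz axy axz ayz)
    obtain ⟨a, ha⟩ := Finset.card_pos.1 (by omega : 0 < A.card)
    have hss : insert a (S \ A) ⊂ S := by
      refine (Finset.insert_subset (hAS.subset ha) Finset.sdiff_subset).ssubset_of_ne fun heq => ?_
      have h1 := Finset.card_sdiff_add_card_eq_card hAS.subset
      have h2 := Finset.card_insert_le a (S \ A)
      rw [heq] at h2
      omega
    refine RigidOn.substitute hAS.subset ha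
      (ih A hAS H ⟨a, ha⟩ (hsp.mono hAS.subset) hAt)
      (ih _ hss _ (Finset.insert_nonempty _ _) (hsp.contractTo hAS.subset ha hAt hAd)
        (ht.contractTo hAS.subset ha hAt hAd)) ?_ ?_
    · exact fun v hv w hw => (contractTo_adj_of_notMem ha (Finset.mem_sdiff.1 hv).2
        (Finset.mem_sdiff.1 hw).2).1
    · exact fun w hw => (contractTo_adj_left ha (Finset.mem_sdiff.1 hw).2).1
  · push Not at hdeg
    obtain ⟨v, hv, hlt⟩ := hdeg
    have hd : adjCount H {v} S = 2 :=
      le_antisymm (by omega) (hsp.two_le_adjCount ht hcard hv)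
    have hrig := ih _ (Finset.erase_ssubset hv) H (herase v hv) (hsp.mono (hsub v))
      (ht.erase hv hd)
    rw [adjCount_singleton_left] at hd
    obtain ⟨x, y, hxy, hN⟩ := Finset.card_eq_two.1
      (show (S.filter (H.Adj v)).card = 2 by exact_mod_cast hd)
    have hmem : ∀ w ∈ ({x, y} : Finset V), w ∈ S.erase v ∧ H.Adj v w := by
      intro w hw
      rw [← hN, Finset.mem_filter] at hw
      exact ⟨Finset.mem_erase.2 ⟨hw.2.ne', hw.1⟩, hw.2⟩
    obtain ⟨hx, hvx⟩ := hmem x (by simp)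
    obtain ⟨hy, hvy⟩ := hmem y (by simp)
    rw [← Finset.insert_erase hv]
    exact hrig.insert_of_two_adj hdim (Finset.notMem_erase v S) hx hy hxy hvx hvy

end Rigidity

section EdgeConnectivity

variable {V : Type*} [Fintype V] [DecidableEq V]

theorem four_le_adjCount_compl {G : SimpleGraph V}
    (h4ec : ∀ F : Set (Sym2 V), F ⊆ G.edgeSet → F.ncard ≤ 3 → (G.deleteEdges F).Connected)
    {P : Finset V} (hP : P.Nonempty) (hP' : Pᶜ.Nonempty) : 4 ≤ adjCount G P Pᶜ := by
  classical
  by_contra! hlt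
  let D : Finset (Sym2 V) :=
    ((P ×ˢ Pᶜ).filter fun e => G.Adj e.1 e.2).image fun e => s(e.1, e.2)
  have hcount : adjCount G P Pᶜ = ((P ×ˢ Pᶜ).filter fun e => G.Adj e.1 e.2).card := by
    unfold adjCount
    rw [← Finset.sum_product', Finset.sum_boole]
  have hD : (D : Set (Sym2 V)).ncard ≤ 3 := by
    rw [Set.ncard_coe_finset]
    have : D.card ≤ _ := Finset.card_image_le
    omega
  have hDG : (D : Set (Sym2 V)) ⊆ G.edgeSet := by
    intro e he
    obtain ⟨⟨a, b⟩, hab, rfl⟩ := Finset.mem_image.1 (Finset.mem_coe.1 he)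
    exact (Finset.mem_filter.1 hab).2
  obtain ⟨v, hv⟩ := hP
  obtain ⟨w, hw⟩ := hP'
  obtain ⟨p⟩ := (h4ec D hDG hD).preconnected v w
  obtain ⟨d, -, hd1, hd2⟩ := p.exists_boundary_dart (P : Set V) hv
    (by simpa using hw)
  have hadj := d.adj
  rw [SimpleGraph.deleteEdges_adj] at hadj
  refine hadj.2 (Finset.mem_coe.2 (Finset.mem_image.2 ⟨(d.fst, d.snd), ?_, rfl⟩))
  simpa using ⟨⟨hd1, hd2⟩, hadj.1⟩

open SimpleGraph in
/-- A `4`-edge-connected graph contains a spanning `(2,2)`-tight subgraph. -/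
theorem exists_spanning_isTight [Nonempty V] {G : SimpleGraph V}
    (h4ec : ∀ F : Set (Sym2 V), F ⊆ G.edgeSet → F.ncard ≤ 3 → (G.deleteEdges F).Connected) :
    ∃ F ≤ G, SparseOn F Finset.univ ∧ IsTight F Finset.univ := by
  classical
  obtain ⟨F, hF⟩ := (Set.toFinite {F : SimpleGraph V | F ≤ G ∧ SparseOn F Finset.univ}
    ).exists_maximal
    ⟨⊥, bot_le, fun A _ hA => by
      have := hA.card_pos
      simp only [adjCount, bot_adj, if_false, Finset.sum_const_zero]
      omega⟩
  obtain ⟨hFG, hsp⟩ := hF.prop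
  refine ⟨F, hFG, hsp, ?_⟩
  have hedge : ∀ x y, G.Adj x y → ¬F.Adj x y → ∃ A, IsTight F A ∧ x ∈ A ∧ y ∈ A := by
    intro x y hG hn
    by_contra! hno
    have h1 := hF.le_of_ge (y := F ⊔ edge x y) ⟨sup_le hFG ((edge_le_iff G).2 (Or.inr hG)),
      hsp.sup_edge hG.ne hn fun A _ hx hy ht => hno A ht hx hy⟩ le_sup_left
    exact hn (h1 (by simp [edge_adj, hG.ne]))
  have hmax : ∀ v, ∃ M, v ∈ M ∧ IsTight F M ∧ ∀ A, v ∈ A → IsTight F A → A ⊆ M := by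
    intro v
    obtain ⟨M, hM, hmax⟩ := Finset.exists_max_image
      (Finset.univ.filter fun A : Finset V => v ∈ A ∧ IsTight F A) Finset.card
      ⟨{v}, by simp [isTight_singleton]⟩
    simp only [Finset.mem_filter, Finset.mem_univ, true_and] at hM hmax
    refine ⟨M, hM.1, hM.2, fun A hvA hA => ?_⟩
    have hu := hsp.isTight_union (Finset.subset_univ M) (Finset.subset_univ A) hM.2 hA
      ⟨v, Finset.mem_inter.2 ⟨hM.1, hvA⟩⟩
    have := Finset.eq_of_subset_of_card_le (Finset.subset_union_left (s₁ := M) (s₂ := A))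
      (hmax _ ⟨Finset.mem_union_left A hM.1, hu⟩)
    rw [this]
    exact Finset.subset_union_right
  choose M hvM hMt hMmax using hmax
  by_cases huniv : ∃ v, M v = Finset.univ
  · obtain ⟨v, hv⟩ := huniv
    exact hv ▸ hMt v
  exfalso
  push Not at huniv
  have hMeq : ∀ v w, w ∈ M v ↔ M w = M v := by
    refine fun v w => ⟨fun h => ?_, fun h => h ▸ hvM w⟩
    have h1 := hMmax w (M v) h (hMt v)
    exact (hMmax v (M w) (h1 (hvM v)) (hMt w)).antisymm h1
  have hclass : ∀ v, 0 ≤ ∑ w ∈ M v, (adjCount F {w} Finset.univ - 4) := by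
    intro v
    have hcut : adjCount G (M v) (M v)ᶜ = adjCount F (M v) (M v)ᶜ := by
      refine adjCount_congr fun x hx y hy => ⟨fun hG => ?_, fun h => hFG h⟩
      by_contra hn
      obtain ⟨A, hA, hxA, hyA⟩ := hedge x y hG hn
      refine Finset.mem_compl.1 hy (?_ : y ∈ M v)
      rw [← (hMeq v x).1 hx]
      exact hMmax x A hxA hA hyA
    have h4 := four_le_adjCount_compl h4ec ⟨v, hvM v⟩
      (Finset.nonempty_iff_ne_empty.2 fun h => huniv v ((Finset.compl_eq_empty_iff _).1 h))
    have hsum : ∑ w ∈ M v, adjCount F {w} Finset.univ = adjCount F (M v) Finset.univ := by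
      simp [adjCount]
    have hsplit := adjCount_union_right F (disjoint_compl_right (a := M v)) (M v)
    rw [Finset.union_compl] at hsplit
    have ht : adjCount F (M v) (M v) = _ := hMt v
    rw [Finset.sum_sub_distrib, hsum, hsplit, ht, Finset.sum_const, nsmul_eq_mul]
    linarith
  have hfib := Finset.sum_fiberwise_of_maps_to (s := Finset.univ)
    (t := Finset.univ.image M) (g := M) (fun v hv => Finset.mem_image_of_mem M hv)
    (fun w => adjCount F {w} Finset.univ - 4)
  have hnonneg : 0 ≤ ∑ w : V, (adjCount F {w} Finset.univ - 4) := by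
    rw [← hfib]
    refine Finset.sum_nonneg fun P hP => ?_
    obtain ⟨v, -, rfl⟩ := Finset.mem_image.1 hP
    rw [show (Finset.univ.filter fun w => M w = M v) = M v by ext w; simp [hMeq]]
    exact hclass v
  have hsum : ∑ w : V, adjCount F {w} Finset.univ = adjCount F Finset.univ Finset.univ := by
    simp [adjCount]
  have htop := hsp Finset.univ Finset.Subset.rfl Finset.univ_nonempty
  rw [Finset.sum_sub_distrib, hsum, Finset.sum_const, nsmul_eq_mul] at hnonneg
  linarith

end EdgeConnectivity

end

/-- Every 4-edge-connected finite simple graph (with at least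
two vertices) is rigid in every non-Euclidean normed plane. -/
theorem four_edge_connected_rigid_in_nonEuclidean_plane
    (V : Type*) [Fintype V] (hV : 2 ≤ Fintype.card V)
    (G : SimpleGraph V) (hconn : G.Connected)
    (h4ec : ∀ F : Set (Sym2 V), F ⊆ G.edgeSet → F.ncard ≤ 3 →
      (G.deleteEdges F).Connected)
    (X : Type*) [NormedAddCommGroup X] [NormedSpace ℝ X]
    (hdim : Module.finrank ℝ X = 2)
    (hnE : ∃ x y : X, ‖x + y‖ ^ 2 + ‖x - y‖ ^ 2 ≠ 2 * ‖x‖ ^ 2 + 2 * ‖y‖ ^ 2) :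
    ∃ p : V → X,
      (∀ v w : V, G.Adj v w → DifferentiableAt ℝ (fun x : X => ‖x‖) (p v - p w)) ∧
      ∀ u : V → X,
        (∀ v w : V, G.Adj v w →
          fderiv ℝ (fun x : X => ‖x‖) (p v - p w) (u v - u w) = 0) →
        ∃ c : X, ∀ v, u v = c := by
  classical
  have hne : Nonempty V := Fintype.card_pos_iff.1 (by omega)
  obtain ⟨F, hFG, hsp, ht⟩ := exists_spanning_isTight h4ec
  obtain ⟨p, hp, hrig⟩ := rigidOn_of_isTight hdim hnE Finset.univ F Finset.univ_nonempty hsp ht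
  refine ⟨p, fun v w hvw => hp v (Finset.mem_univ v) w (Finset.mem_univ w) hvw.ne, fun u hu => ?_⟩
  have hconst := hrig u fun v _ w _ hvw => hu v w (hFG hvw)
  exact ⟨u hne.some, fun v => hconst v (Finset.mem_univ v) _ (Finset.mem_univ _)⟩
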